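/- Let n ≥ 1 and let S ⊆ ℝ^n be a Borel set with S ∩ (−S) = ∅ and λ = Vol_n(S) ∈ (0, ∞). Let μ be any SL_n(ℝ)-invariant Borel probability measure on the space 𝒳_n of covolume-one lattices in ℝ^n. Then for every integer k with 1 ≤ k ≤ n − 1, ∫_{𝒳_n} ρ_k^{k−1}(L ∩ S) dμ(L) ≤ (λ^{k−1}/(k−1)!) · ( 3^k (3/4)^{n/2} + 5^k 2^{−n} ), the integrand being defined for μ-almost every L (L ∩ S is finite for μ-almost every L). -/

import Mathlib

open MeasureTheory Pointwise
open scoped ENNReal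

noncomputable section

/-- `SL(n, ℝ)`, the special linear group of `n × n` real matrices of determinant one. -/
abbrev SLR (n : ℕ) := Matrix.SpecialLinearGroup (Fin n) ℝ

/-- The topology on `SL(n, ℝ)` induced from the space of matrices. -/
instance (n : ℕ) : TopologicalSpace (SLR n) :=
  TopologicalSpace.induced (fun g => (g : Matrix (Fin n) (Fin n) ℝ)) inferInstance

/-- The subgroup `SL(n, ℤ)` of `SL(n, ℝ)` (the range of the coefficient-wise
integer-to-real map on special linear groups). -/
def SLZ (n : ℕ) : Subgroup (SLR n) :=
  MonoidHom.range (Matrix.SpecialLinearGroup.map (n := Fin n) (Int.castRingHom ℝ))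

/-- The space `𝒳ₙ = SL(n, ℝ) / SL(n, ℤ)` of lattices of covolume one in `ℝⁿ`. -/
def LatticeSpace (n : ℕ) := SLR n ⧸ SLZ n

instance (n : ℕ) : TopologicalSpace (LatticeSpace n) :=
  inferInstanceAs (TopologicalSpace (SLR n ⧸ SLZ n))

/-- The Borel σ-algebra on the space of lattices. -/
instance (n : ℕ) : MeasurableSpace (LatticeSpace n) := borel _

/-- The action of `SL(n, ℝ)` on the space of lattices, `g.L = {g x : x ∈ L}`. -/
instance (n : ℕ) : MulAction (SLR n) (LatticeSpace n) :=
  inferInstanceAs (MulAction (SLR n) (SLR n ⧸ SLZ n))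

/-- The lattice `{g v : v ∈ ℤⁿ} ⊆ ℝⁿ` associated to a point of `LatticeSpace n`,
computed via a representative `g` of the coset (the resulting set of vectors does not
depend on the choice of representative, since `SL(n, ℤ)` preserves `ℤⁿ`). -/
def latticeOf {n : ℕ} (L : LatticeSpace n) : Set (Fin n → ℝ) :=
  {y | ∃ v : Fin n → ℤ,
    y = (Quotient.out (α := SLR n) L).1.mulVec (fun i => (v i : ℝ))}

/-- `rank X`: the dimension of the linear span of `X ⊆ ℝⁿ`. -/
def rankOf {n : ℕ} (X : Set (Fin n → ℝ)) : ℕ :=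
  Module.finrank ℝ ↥(Submodule.span ℝ X)

/-- `ρₖʲ(A)`: the number of subsets `X ⊆ A` with `|X| = k` and `rank X = j`. -/
def rho {n : ℕ} (k j : ℕ) (A : Set (Fin n → ℝ)) : ℕ :=
  Set.ncard {X : Set (Fin n → ℝ) | X ⊆ A ∧ X.ncard = k ∧ rankOf X = j}

/-- The primitive of the Gaussian `exp (-s ^ 2)` vanishing at the origin. -/
def gaussPrim (u : ℝ) : ℝ := ∫ s in (0 : ℝ)..u, Real.exp (-s ^ 2)

theorem continuous_exp_neg_sq : Continuous fun s : ℝ => Real.exp (-s ^ 2) := by fun_prop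

theorem integrable_exp_neg_sq : Integrable fun s : ℝ => Real.exp (-s ^ 2) := by
  simpa using integrable_exp_neg_mul_sq (b := 1) one_pos

theorem hasStrictDerivAt_gaussPrim (u : ℝ) :
    HasStrictDerivAt gaussPrim (Real.exp (-u ^ 2)) u :=
  intervalIntegral.integral_hasStrictDerivAt_right
    (continuous_exp_neg_sq.intervalIntegrable _ _)
    (continuous_exp_neg_sq.stronglyMeasurableAtFilter _ _)
    continuous_exp_neg_sq.continuousAt

theorem strictMono_gaussPrim : StrictMono gaussPrim := by
  refine strictMono_of_deriv_pos fun u => ?_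
  rw [(hasStrictDerivAt_gaussPrim u).hasDerivAt.deriv]
  positivity

theorem gaussPrim_neg (u : ℝ) : gaussPrim (-u) = -gaussPrim u := by
  have h := intervalIntegral.integral_comp_neg (a := 0) (b := u) fun s : ℝ => Real.exp (-s ^ 2)
  simp only [neg_sq, neg_zero] at h
  rw [gaussPrim, gaussPrim, h, intervalIntegral.integral_symm]

theorem tendsto_gaussPrim_atTop :
    Filter.Tendsto gaussPrim Filter.atTop (nhds (√Real.pi / 2)) := by
  have h := intervalIntegral_tendsto_integral_Ioi (μ := volume) 0
    (integrable_exp_neg_sq.integrableOn (s := Set.Ioi 0)) Filter.tendsto_id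
  have h2 := integral_gaussian_Ioi 1
  simp only [div_one, neg_mul, one_mul] at h2
  rw [h2] at h
  exact h

theorem exists_gaussPrim_eq {v : ℝ} (h1 : -(√Real.pi / 2) < v) (h2 : v < √Real.pi / 2) :
    ∃ u, gaussPrim u = v := by
  obtain ⟨b, hb⟩ := (tendsto_gaussPrim_atTop.eventually (lt_mem_nhds h2)).exists
  obtain ⟨a, ha⟩ := (tendsto_gaussPrim_atTop.eventually
    (lt_mem_nhds (show -v < √Real.pi / 2 by linarith))).exists
  have hc : Continuous gaussPrim :=
    continuous_iff_continuousAt.2 fun u => (hasStrictDerivAt_gaussPrim u).hasDerivAt.continuousAt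
  refine mem_range_of_exists_le_of_exists_ge hc ⟨-a, ?_⟩ ⟨b, hb.le⟩
  rw [gaussPrim_neg]
  linarith

/-- The increasing rearrangement of a probability density onto the Gaussian density
`exp (-s ^ 2) / √π`, on a set carrying the whole mass. -/
theorem exists_transport_gaussian {f : ℝ → ℝ≥0∞} (hf : Measurable f) (h1 : ∫⁻ t, f t = 1) :
    ∃ (T T' : ℝ → ℝ) (s : Set ℝ), MeasurableSet s ∧ StrictMonoOn T s ∧
      (∀ t ∈ s, HasDerivAt T (T' t) t ∧ 0 < T' t ∧
        f t = ENNReal.ofReal (T' t * Real.exp (-T t ^ 2) / √Real.pi)) ∧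
      ∀ᵐ t, t ∉ s → f t = 0 := by
  set P : Measure ℝ := volume.withDensity f with hP
  have : IsProbabilityMeasure P := ⟨by rw [hP, withDensity_apply _ .univ]; simpa using h1⟩
  set F := ProbabilityTheory.cdf P with hF
  have hmono : Monotone F := F.mono
  have hder : ∀ᵐ t, HasDerivAt F (f t).toReal t := by
    have h := F.ae_hasDerivAt
    rw [ProbabilityTheory.measure_cdf] at h
    filter_upwards [h, Measure.rnDeriv_withDensity volume hf] with t ht ht2
    rwa [ht2] at ht
  have hfin : ∀ᵐ t, f t < ⊤ := ae_lt_top hf (by simp [h1])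
  obtain ⟨N, hNsub, hNmeas, hN0⟩ := exists_measurable_superset_of_null
    (ae_iff.1 (hder.and hfin))
  have hgood : ∀ t ∉ N, HasDerivAt F (f t).toReal t ∧ f t < ⊤ := fun t ht => by
    by_contra hcon
    exact ht (hNsub hcon)
  have hlt : ∀ t ∉ N, f t ≠ 0 → ∀ t', (t < t' → F t < F t') ∧ (t' < t → F t' < F t) := by
    intro t ht h0 t'
    have hd := (hgood t ht).1
    have hpos : 0 < (f t).toReal := ENNReal.toReal_pos h0 (hgood t ht).2.ne
    refine ⟨fun htt => ?_, fun htt => ?_⟩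
    · have := hd.hasDerivWithinAt (s := Set.Ioi t)
      have h3 := (hasDerivWithinAt_iff_tendsto_slope' (by simp)).1 this
      have h4 := (h3.eventually (lt_mem_nhds hpos)).and
        (Ioo_mem_nhdsGT htt)
      obtain ⟨y, hy1, hy2⟩ := h4.exists
      have : 0 < F y - F t := by
        rw [slope_def_field] at hy1
        have hyt : 0 < y - t := sub_pos.2 hy2.1
        have := mul_pos hy1 hyt
        rwa [div_mul_cancel₀ _ hyt.ne'] at this
      linarith [hmono hy2.2.le]
    · have := hd.hasDerivWithinAt (s := Set.Iio t)
      have h3 := (hasDerivWithinAt_iff_tendsto_slope' (by simp)).1 this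
      have h4 := (h3.eventually (lt_mem_nhds hpos)).and
        (Ioo_mem_nhdsLT htt)
      obtain ⟨y, hy1, hy2⟩ := h4.exists
      have : 0 < F t - F y := by
        rw [slope_def_field] at hy1
        have hyt : 0 < t - y := sub_pos.2 hy2.2
        have := mul_pos hy1 hyt
        rw [← neg_sub (F t), ← neg_sub t, neg_div_neg_eq, div_mul_cancel₀ _ hyt.ne'] at this
        exact this
      linarith [hmono hy2.1.le]
  set s : Set ℝ := {t | f t ≠ 0} \ N with hs
  have hsm : MeasurableSet s := ((hf (measurableSet_singleton 0)).compl).diff hNmeas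
  have hpi : 0 < √Real.pi := Real.sqrt_pos.2 Real.pi_pos
  have hex : ∀ t ∈ s, ∃ u, gaussPrim u = √Real.pi * (F t - 1 / 2) := by
    intro t ht
    have ha := (hlt t ht.2 ht.1 (t - 1)).2 (by linarith)
    have hb := (hlt t ht.2 ht.1 (t + 1)).1 (by linarith)
    have hc := ProbabilityTheory.cdf_nonneg P (t - 1)
    have hd := ProbabilityTheory.cdf_le_one P (t + 1)
    apply exists_gaussPrim_eq <;> nlinarith
  set Ψ := Function.invFun gaussPrim with hΨ
  have hleft : Function.LeftInverse Ψ gaussPrim :=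
    Function.leftInverse_invFun strictMono_gaussPrim.injective
  refine ⟨fun t => Ψ (√Real.pi * (F t - 1 / 2)),
    fun t => (Real.exp (-(Ψ (√Real.pi * (F t - 1 / 2))) ^ 2))⁻¹ * (√Real.pi * (f t).toReal),
    s, hsm, ?_, ?_, ?_⟩
  · intro t ht t' ht' htt
    obtain ⟨u, hu⟩ := hex t ht
    obtain ⟨u', hu'⟩ := hex t' ht'
    simp only [← hu, ← hu', hleft u, hleft u']
    rw [← strictMono_gaussPrim.lt_iff_lt, hu, hu']
    have := (hlt t ht.2 ht.1 t').1 htt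
    exact mul_lt_mul_of_pos_left (by linarith) hpi
  · intro t ht
    obtain ⟨u, hu⟩ := hex t ht
    have hpos : 0 < (f t).toReal := ENNReal.toReal_pos ht.1 (hgood t ht.2).2.ne
    refine ⟨?_, ?_, ?_⟩
    · have h2 := (hasStrictDerivAt_gaussPrim u).to_local_left_inverse (by positivity)
        (g := Ψ) (Filter.Eventually.of_forall hleft)
      rw [hu] at h2
      have h3 : Ψ (√Real.pi * (F t - 1 / 2)) = u := by rw [← hu, hleft u]
      beta_reduce
      rw [h3]
      exact h2.hasDerivAt.comp t ((((hgood t ht.2).1.sub_const (1 / 2))).const_mul √Real.pi)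
    · positivity
    · rw [← ENNReal.ofReal_toReal (hgood t ht.2).2.ne]
      congr 1
      field_simp
  · filter_upwards [measure_eq_zero_iff_ae_notMem.1 hN0] with t ht hts
    by_contra h0
    exact hts ⟨h0, ht⟩

theorem lintegral_gaussian_quadratic :
    ∫⁻ p : ℝ × ℝ, ENNReal.ofReal
      (Real.exp (-(4 / 9) * (p.1 ^ 2 + p.2 ^ 2 - p.1 * p.2)) / (3 * Real.pi))
      = ENNReal.ofReal (√3 / 2) := by
  have hg : ∀ b : ℝ, 0 < b → ∫⁻ x : ℝ, ENNReal.ofReal (Real.exp (-b * x ^ 2))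
      = ENNReal.ofReal √(Real.pi / b) := by
    intro b hb
    rw [← ofReal_integral_eq_lintegral_ofReal (integrable_exp_neg_mul_sq hb)
      (Filter.Eventually.of_forall fun x => (Real.exp_pos _).le), integral_gaussian]
  rw [Measure.volume_eq_prod, lintegral_prod _ (by fun_prop)]
  have inner : ∀ x : ℝ, ∫⁻ y : ℝ, ENNReal.ofReal
      (Real.exp (-(4 / 9) * (x ^ 2 + y ^ 2 - x * y)) / (3 * Real.pi))
      = ENNReal.ofReal (Real.exp (-(1 / 3) * x ^ 2)) *
        (ENNReal.ofReal (√(Real.pi / (4 / 9)) / (3 * Real.pi))) := by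
    intro x
    have : ∀ y : ℝ, ENNReal.ofReal
        (Real.exp (-(4 / 9) * (x ^ 2 + y ^ 2 - x * y)) / (3 * Real.pi))
        = ENNReal.ofReal (Real.exp (-(1 / 3) * x ^ 2) / (3 * Real.pi)) *
          ENNReal.ofReal (Real.exp (-(4 / 9) * (y - x / 2) ^ 2)) := by
      intro y
      rw [← ENNReal.ofReal_mul (by positivity), div_mul_eq_mul_div, ← Real.exp_add]
      congr 3
      ring
    simp_rw [this]
    rw [lintegral_const_mul _ (by fun_prop),
      lintegral_sub_right_eq_self (fun y => ENNReal.ofReal (Real.exp (-(4 / 9) * y ^ 2))) (x / 2),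
      hg _ (by norm_num), ← ENNReal.ofReal_mul (by positivity),
      ← ENNReal.ofReal_mul (by positivity)]
    congr 1
    ring
  simp only [inner]
  rw [lintegral_mul_const _ (by fun_prop), hg _ (by norm_num),
    ← ENNReal.ofReal_mul (by positivity)]
  congr 1
  have h1 : √(Real.pi / (1 / 3)) = √3 * √Real.pi := by
    rw [← Real.sqrt_mul (by norm_num)]; congr 1; ring
  have h2 : √(Real.pi / (4 / 9)) = 3 / 2 * √Real.pi := by
    rw [show Real.pi / (4 / 9) = (3 / 2) ^ 2 * Real.pi by ring, Real.sqrt_mul (by positivity),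
      Real.sqrt_sq (by norm_num)]
  rw [h1, h2]
  have h3 : √Real.pi * √Real.pi = Real.pi := Real.mul_self_sqrt Real.pi_pos.le
  have := Real.pi_pos
  field_simp
  nlinarith

theorem rpow_two_thirds_mul_le {a b c : ℝ} (ha : 0 ≤ a) (hb : 0 ≤ b) (hc : 0 ≤ c) :
    (a * b * c) ^ (2 / 3 : ℝ) ≤ (a * b + a * c + b * c) / 3 := by
  have h := Real.geom_mean_le_arith_mean3_weighted (w₁ := 1 / 3) (w₂ := 1 / 3) (w₃ := 1 / 3)
    (p₁ := a * b) (p₂ := a * c) (p₃ := b * c) (by norm_num) (by norm_num) (by norm_num)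
    (by positivity) (by positivity) (by positivity) (by norm_num)
  rw [← Real.mul_rpow (by positivity) (by positivity),
    ← Real.mul_rpow (by positivity) (by positivity),
    show a * b * (a * c) * (b * c) = (a * b * c) ^ (2 : ℝ) by rw [Real.rpow_two]; ring,
    ← Real.rpow_mul (by positivity)] at h
  norm_num at h
  linarith

theorem transport_pointwise_bound {a b c : ℝ} (ha : 0 < a) (hb : 0 < b) (hc : 0 < c)
    (t u v : ℝ) :
    (a * Real.exp (-t ^ 2) / √Real.pi * (b * Real.exp (-u ^ 2) / √Real.pi) *
      (c * Real.exp (-v ^ 2) / √Real.pi)) ^ (2 / 3 : ℝ) ≤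
    (a * b + a * c + b * c) * (Real.exp (-(4 / 9) *
      ((t + v) ^ 2 + (u + v) ^ 2 - (t + v) * (u + v))) / (3 * Real.pi)) := by
  have hpi := Real.pi_pos
  have h1 : a * Real.exp (-t ^ 2) / √Real.pi * (b * Real.exp (-u ^ 2) / √Real.pi) *
      (c * Real.exp (-v ^ 2) / √Real.pi) =
      a * b * c * Real.exp (-(t ^ 2 + u ^ 2 + v ^ 2)) * (Real.pi ^ (3 / 2 : ℝ))⁻¹ := by
    have : Real.pi ^ (3 / 2 : ℝ) = √Real.pi * √Real.pi * √Real.pi := by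
      rw [Real.mul_self_sqrt hpi.le, Real.sqrt_eq_rpow, ← Real.rpow_one_add' hpi.le (by norm_num)]
      norm_num
    rw [this, show -(t ^ 2 + u ^ 2 + v ^ 2) = -t ^ 2 + -u ^ 2 + -v ^ 2 by ring, Real.exp_add,
      Real.exp_add]
    field_simp
  rw [h1, Real.mul_rpow (by positivity) (by positivity),
    Real.mul_rpow (by positivity) (by positivity), ← Real.exp_mul,
    Real.inv_rpow (by positivity), ← Real.rpow_mul hpi.le]
  norm_num
  have h2 := rpow_two_thirds_mul_le ha.le hb.le hc.le
  have h3 : Real.exp (-((v ^ 2 + (u ^ 2 + t ^ 2)) * (2 / 3))) ≤ Real.exp (-(4 / 9 *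
      ((t + v) ^ 2 + (u + v) ^ 2 - (t + v) * (u + v)))) := by
    apply Real.exp_le_exp.2
    nlinarith [sq_nonneg (t + u - v)]
  have h4 : Real.exp ((-(v ^ 2) + (-(u ^ 2) + -(t ^ 2))) * (2 / 3)) =
    Real.exp (-((v ^ 2 + (u ^ 2 + t ^ 2)) * (2 / 3))) := by congr 1; ring
  calc _ ≤ (a * b + a * c + b * c) / 3 * Real.exp (-(4 / 9 *
      ((t + v) ^ 2 + (u + v) ^ 2 - (t + v) * (u + v)))) * Real.pi⁻¹ := by
        gcongr
        nlinarith [sq_nonneg (t + u - v)]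
    _ = _ := by field_simp

/-- The geometric Brascamp-Lieb inequality behind the sharp Young inequality on the line, for
probability densities, proved by transport to the Gaussian. -/
theorem young_line_of_lintegral_eq_one {f g h : ℝ → ℝ≥0∞} (hf : Measurable f) (hg : Measurable g)
    (hh : Measurable h) (hf1 : ∫⁻ t, f t = 1) (hg1 : ∫⁻ t, g t = 1) (hh1 : ∫⁻ t, h t = 1) :
    ∫⁻ x, ∫⁻ y, (f x * g y * h (x + y)) ^ (2 / 3 : ℝ) ≤ ENNReal.ofReal (√3 / 2) := by
  obtain ⟨T₁, T₁', s₁, hs₁, hm₁, hd₁, ha₁⟩ := exists_transport_gaussian hf hf1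
  obtain ⟨T₂, T₂', s₂, hs₂, hm₂, hd₂, ha₂⟩ := exists_transport_gaussian hg hg1
  obtain ⟨T₃, T₃', s₃, hs₃, hm₃, hd₃, ha₃⟩ := exists_transport_gaussian hh hh1
  set E : Set (ℝ × ℝ) := {z | z.1 ∈ s₁ ∧ z.2 ∈ s₂ ∧ z.1 + z.2 ∈ s₃} with hE
  have hEm : MeasurableSet E := (measurable_fst hs₁).inter
    ((measurable_snd hs₂).inter ((measurable_fst.add measurable_snd) hs₃))
  have hmeas : Measurable fun z : ℝ × ℝ => (f z.1 * g z.2 * h (z.1 + z.2)) ^ (2 / 3 : ℝ) := by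
    fun_prop
  have step1 : ∫⁻ x, ∫⁻ y, (f x * g y * h (x + y)) ^ (2 / 3 : ℝ)
      = ∫⁻ z in E, (f z.1 * g z.2 * h (z.1 + z.2)) ^ (2 / 3 : ℝ) := by
    rw [← lintegral_indicator hEm, Measure.volume_eq_prod,
      lintegral_prod _ (hmeas.indicator hEm).aemeasurable]
    refine lintegral_congr_ae ?_
    filter_upwards [ha₁] with x hx
    refine lintegral_congr_ae ?_
    have h3 : ∀ᵐ y, x + y ∉ s₃ → h (x + y) = 0 :=
      (measurePreserving_add_left volume x).quasiMeasurePreserving.ae ha₃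
    filter_upwards [ha₂, h3] with y hy hxy
    by_cases hz : (x, y) ∈ E
    · rw [Set.indicator_of_mem hz]
    · rw [Set.indicator_of_notMem hz]
      have : f x * g y * h (x + y) = 0 := by
        by_contra hne
        simp only [mul_eq_zero, not_or] at hne
        exact hz ⟨by_contra fun hc => hne.1.1 (hx hc), by_contra fun hc => hne.1.2 (hy hc),
          by_contra fun hc => hne.2 (hxy hc)⟩
      rw [this, ENNReal.zero_rpow_of_pos (by norm_num)]
  set Θ : ℝ × ℝ → ℝ × ℝ := fun z => (T₁ z.1 + T₃ (z.1 + z.2), T₂ z.2 + T₃ (z.1 + z.2)) with hΘ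
  set Θ' : ℝ × ℝ → ℝ × ℝ →L[ℝ] ℝ × ℝ := fun z =>
    (Matrix.toLin (.finTwoProd ℝ) (.finTwoProd ℝ)
      !![T₁' z.1 + T₃' (z.1 + z.2), T₃' (z.1 + z.2);
        T₃' (z.1 + z.2), T₂' z.2 + T₃' (z.1 + z.2)]).toContinuousLinearMap with hΘ'
  have hdet : ∀ z, (Θ' z).det = T₁' z.1 * T₂' z.2 + T₁' z.1 * T₃' (z.1 + z.2)
      + T₂' z.2 * T₃' (z.1 + z.2) := by
    intro z
    simp only [hΘ', LinearMap.det_toContinuousLinearMap, LinearMap.det_toLin, Matrix.det_fin_two_of]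
    ring
  have hderiv : ∀ z ∈ E, HasFDerivWithinAt Θ (Θ' z) E z := by
    intro z hz
    apply HasFDerivAt.hasFDerivWithinAt
    simp only [hΘ']
    rw [Matrix.toLin_finTwoProd_toContinuousLinearMap]
    have e1 : HasFDerivAt Prod.fst (ContinuousLinearMap.fst ℝ ℝ ℝ) z := hasFDerivAt_fst
    have e2 : HasFDerivAt Prod.snd (ContinuousLinearMap.snd ℝ ℝ ℝ) z := hasFDerivAt_snd
    have d1 := (hd₁ _ hz.1).1.comp_hasFDerivAt z e1
    have d2 := (hd₂ _ hz.2.1).1.comp_hasFDerivAt z e2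
    have d3 := (hd₃ _ hz.2.2).1.comp_hasFDerivAt z (e1.add e2)
    have := (d1.add d3).prodMk (d2.add d3)
    convert! this using 2
    · module
    · module
  have hinj : Set.InjOn Θ E := by
    intro z hz w hw hzw
    simp only [hΘ, Prod.mk.injEq] at hzw
    obtain ⟨e1, e2⟩ := hzw
    have k1 := hm₁.lt_iff_lt hz.1 hw.1
    have k1' := hm₁.lt_iff_lt hw.1 hz.1
    have k2 := hm₂.lt_iff_lt hz.2.1 hw.2.1
    have k2' := hm₂.lt_iff_lt hw.2.1 hz.2.1
    have k3 := hm₃.lt_iff_lt hz.2.2 hw.2.2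
    have k3' := hm₃.lt_iff_lt hw.2.2 hz.2.2
    rcases lt_trichotomy (z.1 + z.2) (w.1 + w.2) with hc | hc | hc
    · have := k3.2 hc
      have a1 := k1'.1 (by linarith)
      have a2 := k2'.1 (by linarith)
      linarith
    · rw [hc] at e1 e2
      have b1 : z.1 = w.1 := hm₁.injOn hz.1 hw.1 (by linarith)
      have b2 : z.2 = w.2 := hm₂.injOn hz.2.1 hw.2.1 (by linarith)
      exact Prod.ext b1 b2
    · have := k3'.2 hc
      have a1 := k1.1 (by linarith)
      have a2 := k2.1 (by linarith)
      linarith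
  rw [step1]
  set G : ℝ × ℝ → ℝ≥0∞ := fun p => ENNReal.ofReal
    (Real.exp (-(4 / 9) * (p.1 ^ 2 + p.2 ^ 2 - p.1 * p.2)) / (3 * Real.pi)) with hG
  calc ∫⁻ z in E, (f z.1 * g z.2 * h (z.1 + z.2)) ^ (2 / 3 : ℝ)
      ≤ ∫⁻ z in E, ENNReal.ofReal |(Θ' z).det| * G (Θ z) := by
        refine setLIntegral_mono' hEm fun z hz => ?_
        obtain ⟨-, p1, q1⟩ := hd₁ _ hz.1
        obtain ⟨-, p2, q2⟩ := hd₂ _ hz.2.1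
        obtain ⟨-, p3, q3⟩ := hd₃ _ hz.2.2
        rw [q1, q2, q3, ← ENNReal.ofReal_mul (by positivity), ← ENNReal.ofReal_mul (by positivity),
          ENNReal.ofReal_rpow_of_nonneg (by positivity) (by norm_num), hG,
          ← ENNReal.ofReal_mul (by positivity), hdet, abs_of_pos (by positivity)]
        exact ENNReal.ofReal_le_ofReal (transport_pointwise_bound p1 p2 p3 _ _ _)
    _ = ∫⁻ p in Θ '' E, G p :=
        (lintegral_image_eq_lintegral_abs_det_fderiv_mul volume hEm hderiv hinj G).symm
    _ ≤ ∫⁻ p, G p := setLIntegral_le_lintegral _ _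
    _ = _ := lintegral_gaussian_quadratic

/-- The sharp Young inequality on the line with all three exponents equal to `3 / 2`. -/
theorem young_line {f g h : ℝ → ℝ≥0∞} (hf : Measurable f) (hg : Measurable g)
    (hh : Measurable h) :
    ∫⁻ x, ∫⁻ y, (f x * g y * h (x + y)) ^ (2 / 3 : ℝ) ≤
      ENNReal.ofReal (√3 / 2) * ((∫⁻ t, f t) * (∫⁻ t, g t) * ∫⁻ t, h t) ^ (2 / 3 : ℝ) := by
  have hz : (0 : ℝ≥0∞) ^ (2 / 3 : ℝ) = 0 := ENNReal.zero_rpow_of_pos (by norm_num)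
  by_cases hf0 : ∫⁻ t, f t = 0
  · have : ∫⁻ x, ∫⁻ y, (f x * g y * h (x + y)) ^ (2 / 3 : ℝ) = 0 := by
      rw [← lintegral_zero (μ := (volume : Measure ℝ))]
      refine lintegral_congr_ae ?_
      filter_upwards [(lintegral_eq_zero_iff hf).1 hf0] with x hx
      simp [hx]
    rw [this]; exact zero_le
  by_cases hg0 : ∫⁻ t, g t = 0
  · have : ∫⁻ x, ∫⁻ y, (f x * g y * h (x + y)) ^ (2 / 3 : ℝ) = 0 := by
      rw [← lintegral_zero (μ := (volume : Measure ℝ))]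
      refine lintegral_congr fun x => ?_
      rw [← lintegral_zero (μ := (volume : Measure ℝ))]
      refine lintegral_congr_ae ?_
      filter_upwards [(lintegral_eq_zero_iff hg).1 hg0] with y hy
      simp [hy]
    rw [this]; exact zero_le
  by_cases hh0 : ∫⁻ t, h t = 0
  · have : ∫⁻ x, ∫⁻ y, (f x * g y * h (x + y)) ^ (2 / 3 : ℝ) = 0 := by
      rw [← lintegral_zero (μ := (volume : Measure ℝ))]
      refine lintegral_congr fun x => ?_
      rw [← lintegral_zero (μ := (volume : Measure ℝ))]
      refine lintegral_congr_ae ?_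
      filter_upwards [(measurePreserving_add_left volume x).quasiMeasurePreserving.ae
        ((lintegral_eq_zero_iff hh).1 hh0)] with y hy
      have hy' : h (x + y) = 0 := hy
      simp [hy']
    rw [this]; exact zero_le
  set a := ∫⁻ t, f t
  set b := ∫⁻ t, g t
  set c := ∫⁻ t, h t
  by_cases htop : a * b * c = ⊤
  · rw [htop, ENNReal.top_rpow_of_pos (by norm_num), ENNReal.mul_top]
    · exact le_top
    · simp
  have hab : a * b ≠ ⊤ := fun hc => htop (by rw [hc, ENNReal.top_mul hh0])
  have hc : c ≠ ⊤ := fun hc => htop (by rw [hc, ENNReal.mul_top (mul_ne_zero hf0 hg0)])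
  have ha : a ≠ ⊤ := fun hc => hab (by rw [hc, ENNReal.top_mul hg0])
  have hb : b ≠ ⊤ := fun hc => hab (by rw [hc, ENNReal.mul_top hf0])
  have key := young_line_of_lintegral_eq_one (f := fun x => a⁻¹ * f x) (g := fun x => b⁻¹ * g x)
    (h := fun x => c⁻¹ * h x) (hf.const_mul _) (hg.const_mul _) (hh.const_mul _)
    (by rw [lintegral_const_mul _ hf]; exact ENNReal.inv_mul_cancel hf0 ha)
    (by rw [lintegral_const_mul _ hg]; exact ENNReal.inv_mul_cancel hg0 hb)
    (by rw [lintegral_const_mul _ hh]; exact ENNReal.inv_mul_cancel hh0 hc)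
  have hscale : ∀ x y, (f x * g y * h (x + y)) ^ (2 / 3 : ℝ) = (a * b * c) ^ (2 / 3 : ℝ) *
      (a⁻¹ * f x * (b⁻¹ * g y) * (c⁻¹ * h (x + y))) ^ (2 / 3 : ℝ) := by
    intro x y
    rw [← ENNReal.mul_rpow_of_nonneg _ _ (by norm_num)]
    congr 1
    calc f x * g y * h (x + y) = (a * a⁻¹) * (b * b⁻¹) * (c * c⁻¹) * (f x * g y * h (x + y)) := by
          rw [ENNReal.mul_inv_cancel hf0 ha, ENNReal.mul_inv_cancel hg0 hb,
            ENNReal.mul_inv_cancel hh0 hc]; simp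
      _ = _ := by ring
  simp_rw [hscale]
  have : ∀ x, ∫⁻ y, (a * b * c) ^ (2 / 3 : ℝ) *
      (a⁻¹ * f x * (b⁻¹ * g y) * (c⁻¹ * h (x + y))) ^ (2 / 3 : ℝ) = (a * b * c) ^ (2 / 3 : ℝ) *
      ∫⁻ y, (a⁻¹ * f x * (b⁻¹ * g y) * (c⁻¹ * h (x + y))) ^ (2 / 3 : ℝ) := by
    intro x
    rw [lintegral_const_mul _ (by fun_prop)]
  simp_rw [this]
  rw [lintegral_const_mul, mul_comm]
  · gcongr
  · exact Measurable.lintegral_prod_right' (f := fun p : ℝ × ℝ =>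
      (a⁻¹ * f p.1 * (b⁻¹ * g p.2) * (c⁻¹ * h (p.1 + p.2))) ^ (2 / 3 : ℝ)) (by fun_prop)

theorem piFinSuccAbove_zero_symm_apply {n : ℕ} (p : ℝ × (Fin n → ℝ)) :
    (MeasurableEquiv.piFinSuccAbove (fun _ : Fin (n + 1) => ℝ) 0).symm p = Fin.cons p.1 p.2 := by
  simp [MeasurableEquiv.piFinSuccAbove, Fin.insertNthEquiv]

theorem lintegral_fin_succ {n : ℕ} {φ : (Fin (n + 1) → ℝ) → ℝ≥0∞} (hφ : Measurable φ) :
    ∫⁻ x, φ x = ∫⁻ t : ℝ, ∫⁻ x : Fin n → ℝ, φ (Fin.cons t x) := by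
  have hmp := (volume_preserving_piFinSuccAbove (fun _ : Fin (n + 1) => ℝ) 0).symm
  rw [← hmp.lintegral_comp hφ, Measure.volume_eq_prod, lintegral_prod]
  · simp only [piFinSuccAbove_zero_symm_apply]
  · exact (hφ.comp (MeasurableEquiv.measurable _)).aemeasurable

theorem measurable_fin_cons {n : ℕ} :
    Measurable fun p : ℝ × (Fin n → ℝ) => (Fin.cons p.1 p.2 : Fin (n + 1) → ℝ) := by
  simp only [← piFinSuccAbove_zero_symm_apply]
  exact (MeasurableEquiv.piFinSuccAbove (fun _ : Fin (n + 1) => ℝ) 0).symm.measurable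

/-- The sharp Young inequality in dimension `n` with all three exponents equal to `3 / 2`. -/
theorem young_pi {n : ℕ} {f g h : (Fin n → ℝ) → ℝ≥0∞} (hf : Measurable f) (hg : Measurable g)
    (hh : Measurable h) :
    ∫⁻ x, ∫⁻ y, (f x * g y * h (x + y)) ^ (2 / 3 : ℝ) ≤
      ENNReal.ofReal (√3 / 2) ^ n * ((∫⁻ t, f t) * (∫⁻ t, g t) * ∫⁻ t, h t) ^ (2 / 3 : ℝ) := by
  induction n with
  | zero =>
    have hsub : ∀ x : Fin 0 → ℝ, x = default := fun x => Subsingleton.elim _ _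
    rw [Measure.volume_pi_eq_dirac (default : Fin 0 → ℝ)]
    simp only [lintegral_dirac, hsub (default + default), pow_zero, one_mul, le_refl]
  | succ n ih =>
    have hcons := measurable_fin_cons (n := n)
    have e1 : ∫⁻ x, ∫⁻ y, (f x * g y * h (x + y)) ^ (2 / 3 : ℝ) = ∫⁻ s, ∫⁻ t, ∫⁻ x, ∫⁻ y,
        (f (Fin.cons s x) * g (Fin.cons t y) * h (Fin.cons (s + t) (x + y))) ^ (2 / 3 : ℝ) := by
      rw [lintegral_fin_succ]
      · refine lintegral_congr fun s => ?_
        have : ∀ x : Fin n → ℝ, ∫⁻ y, (f (Fin.cons s x) * g y * h (Fin.cons s x + y)) ^ (2 / 3 : ℝ)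
            = ∫⁻ t : ℝ, ∫⁻ y : Fin n → ℝ, (f (Fin.cons s x) * g (Fin.cons t y) *
              h (Fin.cons (s + t) (x + y))) ^ (2 / 3 : ℝ) := by
          intro x
          rw [lintegral_fin_succ (by fun_prop)]
          have hadd : ∀ (t : ℝ) (y : Fin n → ℝ), (Fin.cons s x + Fin.cons t y : Fin (n + 1) → ℝ)
              = Fin.cons (s + t) (x + y) := by
            intro t y
            ext i
            refine Fin.cases ?_ (fun i => ?_) i <;> simp
          simp_rw [hadd]
        simp_rw [this]
        refine lintegral_lintegral_swap (f := fun (x : Fin n → ℝ) (t : ℝ) => ∫⁻ y : Fin n → ℝ,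
          (f (Fin.cons s x) * g (Fin.cons t y) * h (Fin.cons (s + t) (x + y))) ^ (2 / 3 : ℝ)) ?_
        apply Measurable.aemeasurable
        apply Measurable.lintegral_prod_right' (f := fun p : ((Fin n → ℝ) × ℝ) × (Fin n → ℝ) =>
          (f (Fin.cons s p.1.1) * g (Fin.cons p.1.2 p.2) *
            h (Fin.cons (s + p.1.2) (p.1.1 + p.2))) ^ (2 / 3 : ℝ))
        have m1 : Measurable fun p : ((Fin n → ℝ) × ℝ) × (Fin n → ℝ) => f (Fin.cons s p.1.1) :=
          hf.comp (hcons.comp (by fun_prop : Measurable fun p : ((Fin n → ℝ) × ℝ) × (Fin n → ℝ) =>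
            (s, p.1.1)))
        have m2 : Measurable fun p : ((Fin n → ℝ) × ℝ) × (Fin n → ℝ) => g (Fin.cons p.1.2 p.2) :=
          hg.comp (hcons.comp (by fun_prop : Measurable fun p : ((Fin n → ℝ) × ℝ) × (Fin n → ℝ) =>
            (p.1.2, p.2)))
        have m3 : Measurable fun p : ((Fin n → ℝ) × ℝ) × (Fin n → ℝ) =>
            h (Fin.cons (s + p.1.2) (p.1.1 + p.2)) :=
          hh.comp (hcons.comp (by fun_prop : Measurable fun p : ((Fin n → ℝ) × ℝ) × (Fin n → ℝ) =>
            (s + p.1.2, p.1.1 + p.2)))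
        fun_prop
      · exact Measurable.lintegral_prod_right' (f := fun p : (Fin (n + 1) → ℝ) × (Fin (n + 1) → ℝ) =>
          (f p.1 * g p.2 * h (p.1 + p.2)) ^ (2 / 3 : ℝ)) (by fun_prop)
    have sec : ∀ φ : (Fin (n + 1) → ℝ) → ℝ≥0∞, Measurable φ → ∀ t : ℝ,
        Measurable fun x : Fin n → ℝ => φ (Fin.cons t x) := fun φ hφ t =>
      hφ.comp (hcons.comp (by fun_prop : Measurable fun x : Fin n → ℝ => (t, x)))
    have mar : ∀ φ : (Fin (n + 1) → ℝ) → ℝ≥0∞, Measurable φ →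
        Measurable fun t : ℝ => ∫⁻ x : Fin n → ℝ, φ (Fin.cons t x) := fun φ hφ =>
      Measurable.lintegral_prod_right' (f := fun p : ℝ × (Fin n → ℝ) => φ (Fin.cons p.1 p.2))
        (hφ.comp hcons)
    rw [e1]
    calc _ ≤ ∫⁻ s, ∫⁻ t, ENNReal.ofReal (√3 / 2) ^ n * ((∫⁻ x : Fin n → ℝ, f (Fin.cons s x)) *
          (∫⁻ x : Fin n → ℝ, g (Fin.cons t x)) * ∫⁻ x : Fin n → ℝ, h (Fin.cons (s + t) x))
            ^ (2 / 3 : ℝ) := by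
          refine lintegral_mono fun s => lintegral_mono fun t => ?_
          exact ih (sec f hf s) (sec g hg t) (sec h hh (s + t))
      _ = ENNReal.ofReal (√3 / 2) ^ n * ∫⁻ s, ∫⁻ t, ((∫⁻ x : Fin n → ℝ, f (Fin.cons s x)) *
          (∫⁻ x : Fin n → ℝ, g (Fin.cons t x)) * ∫⁻ x : Fin n → ℝ, h (Fin.cons (s + t) x))
            ^ (2 / 3 : ℝ) := by
          have hC : ENNReal.ofReal (√3 / 2) ^ n ≠ ⊤ := ENNReal.pow_ne_top ENNReal.ofReal_ne_top
          rw [← lintegral_const_mul' _ _ hC]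
          refine lintegral_congr fun s => ?_
          rw [lintegral_const_mul' _ _ hC]
      _ ≤ ENNReal.ofReal (√3 / 2) ^ n * (ENNReal.ofReal (√3 / 2) *
          ((∫⁻ t, f t) * (∫⁻ t, g t) * ∫⁻ t, h t) ^ (2 / 3 : ℝ)) := by
          gcongr
          rw [lintegral_fin_succ hf, lintegral_fin_succ hg, lintegral_fin_succ hh]
          exact young_line (mar f hf) (mar g hg) (mar h hh)
      _ = _ := by rw [pow_succ, ← mul_assoc]

theorem young_indicator {n : ℕ} {A B C : Set (Fin n → ℝ)} (hA : MeasurableSet A)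
    (hB : MeasurableSet B) (hC : MeasurableSet C) :
    ∫⁻ x, ∫⁻ y, A.indicator 1 x * B.indicator 1 y * C.indicator 1 (x + y) ≤
      ENNReal.ofReal (√3 / 2) ^ n * (volume A * volume B * volume C) ^ (2 / 3 : ℝ) := by
  have h := young_pi (f := A.indicator 1) (g := B.indicator 1) (h := C.indicator 1)
    (measurable_one.indicator hA) (measurable_one.indicator hB) (measurable_one.indicator hC)
  rw [lintegral_indicator_one hA, lintegral_indicator_one hB, lintegral_indicator_one hC] at h
  refine le_of_eq_of_le (lintegral_congr fun x => lintegral_congr fun y => ?_) h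
  by_cases hx : x ∈ A <;> by_cases hy : y ∈ B <;> by_cases hxy : x + y ∈ C <;> simp [hx, hy, hxy]

theorem lintegral_indicator_signs_le {n : ℕ} {S : Set (Fin n → ℝ)} (hS : MeasurableSet S)
    {s t : ℝ} (hs : |s| = 1) (ht : |t| = 1) (z : Fin n → ℝ) :
    ∫⁻ a, ∫⁻ b, S.indicator 1 a * S.indicator 1 b * S.indicator 1 (s • a + t • b + z) ≤
      ENNReal.ofReal (√3 / 2) ^ n * volume S ^ 2 := by
  have flip : ∀ {s : ℝ}, |s| = 1 → ∀ f : (Fin n → ℝ) → ℝ≥0∞, ∫⁻ a, f (s • a) = ∫⁻ a, f a := by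
    intro s hs f
    rcases (abs_eq zero_le_one).1 hs with rfl | rfl
    · simp
    · simp only [neg_smul, one_smul]
      exact lintegral_neg_eq_self f
  have ss : ∀ {s : ℝ}, |s| = 1 → s * s = 1 := fun {s} hs => by
    rw [← abs_mul_abs_self, hs, one_mul]
  have mS : ∀ s : ℝ, MeasurableSet {a : Fin n → ℝ | s • a ∈ S} := fun s =>
    (measurable_const_smul s) hS
  have mz : MeasurableSet {a : Fin n → ℝ | a + z ∈ S} := (measurable_add_const z) hS
  have vS : ∀ {s : ℝ}, |s| = 1 → volume {a : Fin n → ℝ | s • a ∈ S} = volume S := by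
    intro s hs
    have := flip hs (S.indicator 1)
    rw [lintegral_indicator_one hS] at this
    rw [← this, ← lintegral_indicator_one (mS s)]
    rfl
  have vz : volume {a : Fin n → ℝ | a + z ∈ S} = volume S := measure_preimage_add_right _ z S
  have h := young_indicator (mS s) (mS t) mz
  rw [vS hs, vS ht, vz] at h
  have hp : (volume S * volume S * volume S) ^ (2 / 3 : ℝ) = volume S ^ 2 := by
    rw [show volume S * volume S * volume S = volume S ^ (3 : ℝ) by
      rw [show (3 : ℝ) = ((3 : ℕ) : ℝ) by norm_num, ENNReal.rpow_natCast]; ring,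
      ← ENNReal.rpow_mul, show (3 : ℝ) * (2 / 3) = ((2 : ℕ) : ℝ) by norm_num,
      ENNReal.rpow_natCast]
  rw [hp] at h
  refine le_of_eq_of_le ?_ h
  rw [← flip hs]
  refine lintegral_congr fun a => ?_
  rw [← flip ht]
  refine lintegral_congr fun b => ?_
  simp only [smul_smul, ss hs, ss ht, one_smul]
  rfl

theorem volume_pi_sum_mem_le {m n : ℕ} {S : Set (Fin n → ℝ)} (hS : MeasurableSet S)
    (c : Fin m → ℝ) {i j : Fin m} (hij : i ≠ j) (hi : |c i| = 1) (hj : |c j| = 1) :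
    volume {x : Fin m → Fin n → ℝ | (∀ l, x l ∈ S) ∧ ∑ l, c l • x l ∈ S} ≤
      ENNReal.ofReal (√3 / 2) ^ n * volume S ^ m := by
  have mT : MeasurableSet {x : Fin m → Fin n → ℝ | ∀ l, x l ∈ S} := by
    rw [Set.ofPred_forall]
    exact MeasurableSet.iInter fun l => (measurable_pi_apply l) hS
  have mA : MeasurableSet {x : Fin m → Fin n → ℝ | (∀ l, x l ∈ S) ∧ ∑ l, c l • x l ∈ S} := by
    refine mT.inter ?_
    exact (by fun_prop : Measurable fun x : Fin m → Fin n → ℝ => ∑ l, c l • x l) hS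
  have vT : volume {x : Fin m → Fin n → ℝ | ∀ l, x l ∈ S} = volume S ^ m := by
    have : {x : Fin m → Fin n → ℝ | ∀ l, x l ∈ S} = Set.univ.pi fun _ => S := by ext; simp
    rw [this, volume_pi_pi]; simp
  rw [← vT, ← lintegral_indicator_one mA, ← lintegral_indicator_one mT,
    ← lintegral_const_mul _ (measurable_one.indicator mT)]
  have mf : Measurable ({x : Fin m → Fin n → ℝ | (∀ l, x l ∈ S) ∧ ∑ l, c l • x l ∈ S}.indicator
    (1 : (Fin m → Fin n → ℝ) → ℝ≥0∞)) := measurable_one.indicator mA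
  have mg : Measurable fun x => ENNReal.ofReal (√3 / 2) ^ n *
    {x : Fin m → Fin n → ℝ | ∀ l, x l ∈ S}.indicator (1 : (Fin m → Fin n → ℝ) → ℝ≥0∞) x :=
    (measurable_one.indicator mT).const_mul _
  refine lintegral_le_of_lmarginal_le (μ := fun _ => volume) {i, j} mf mg fun x => ?_
  rw [lmarginal_insert _ mf (by simpa using hij), lmarginal_insert _ mg (by simpa using hij)]
  simp only [lmarginal_singleton]
  have key : ∀ a b : Fin n → ℝ, (∀ l, Function.update (Function.update x i a) j b l ∈ S) ↔
      (a ∈ S ∧ b ∈ S) ∧ ∀ l, l ≠ i → l ≠ j → x l ∈ S := by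
    intro a b
    constructor
    · intro h
      refine ⟨⟨by simpa [hij] using h i, by simpa using h j⟩, fun l hl hl' => ?_⟩
      simpa [hl, hl'] using h l
    · rintro ⟨⟨ha, hb⟩, h⟩ l
      by_cases hl' : l = j
      · subst hl'; simpa using hb
      by_cases hl : l = i
      · subst hl; simpa [hl'] using ha
      · simpa [hl, hl'] using h l hl hl'
  have hsum : ∀ a b : Fin n → ℝ, ∑ l, c l • Function.update (Function.update x i a) j b l =
      c i • a + c j • b + ∑ l ∈ (Finset.univ.erase i).erase j, c l • x l := by
    intro a b
    rw [← Finset.add_sum_erase _ _ (Finset.mem_univ i),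
      ← Finset.add_sum_erase _ _ (Finset.mem_erase.2 ⟨hij.symm, Finset.mem_univ j⟩), ← add_assoc]
    congr 1
    · simp [hij]
    · refine Finset.sum_congr rfl fun l hl => ?_
      have h1 := (Finset.mem_erase.1 hl).1
      have h2 := (Finset.mem_erase.1 (Finset.mem_erase.1 hl).2).1
      simp [h1, h2]
  by_cases hx : ∀ l, l ≠ i → l ≠ j → x l ∈ S
  · have e1 : ∀ a b, {x : Fin m → Fin n → ℝ | (∀ l, x l ∈ S) ∧ ∑ l, c l • x l ∈ S}.indicator
        (1 : (Fin m → Fin n → ℝ) → ℝ≥0∞) (Function.update (Function.update x i a) j b) =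
        S.indicator 1 a * S.indicator 1 b * S.indicator 1 (c i • a + c j • b +
          ∑ l ∈ (Finset.univ.erase i).erase j, c l • x l) := by
      intro a b
      rw [← hsum a b]
      classical
      simp only [Set.indicator_apply, Set.mem_ofPred_eq, key a b]
      by_cases ha : a ∈ S <;> by_cases hb : b ∈ S <;> simp_all
    have e2 : ∀ a b, {x : Fin m → Fin n → ℝ | ∀ l, x l ∈ S}.indicator
        (1 : (Fin m → Fin n → ℝ) → ℝ≥0∞) (Function.update (Function.update x i a) j b) =
        S.indicator 1 a * S.indicator 1 b := by
      intro a b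
      classical
      simp only [Set.indicator_apply, Set.mem_ofPred_eq, key a b]
      by_cases ha : a ∈ S <;> by_cases hb : b ∈ S <;> simp_all
    simp_rw [e1, e2]
    have mi : Measurable (S.indicator (1 : (Fin n → ℝ) → ℝ≥0∞)) := measurable_one.indicator hS
    refine (lintegral_indicator_signs_le hS hi hj _).trans (le_of_eq ?_)
    have : ∀ a, ∫⁻ b, ENNReal.ofReal (√3 / 2) ^ n *
        (S.indicator 1 a * S.indicator 1 b) =
        ENNReal.ofReal (√3 / 2) ^ n * volume S * S.indicator 1 a := by
      intro a
      rw [lintegral_const_mul _ (mi.const_mul _), lintegral_const_mul _ mi,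
        lintegral_indicator_one hS]
      ring
    simp_rw [this]
    rw [lintegral_const_mul _ mi, lintegral_indicator_one hS]
    ring
  · have e1 : ∀ a b, {x : Fin m → Fin n → ℝ | (∀ l, x l ∈ S) ∧ ∑ l, c l • x l ∈ S}.indicator
        (1 : (Fin m → Fin n → ℝ) → ℝ≥0∞) (Function.update (Function.update x i a) j b) = 0 := by
      intro a b
      rw [Set.indicator_of_notMem]
      rintro ⟨h, -⟩
      exact hx ((key a b).1 h).2
    simp [e1]

theorem SLR.continuous_coe (n : ℕ) :
    Continuous fun g : SLR n => (g : Matrix (Fin n) (Fin n) ℝ) :=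
  continuous_induced_dom

instance (n : ℕ) : IsTopologicalGroup (SLR n) :=
  (Matrix.SpecialLinearGroup.topologicalGroup : @IsTopologicalGroup (SLR n) _ _)

theorem SLR.isClosedEmbedding_coe (n : ℕ) :
    Topology.IsClosedEmbedding fun g : SLR n => (g : Matrix (Fin n) (Fin n) ℝ) := by
  refine ⟨⟨⟨rfl⟩, Subtype.val_injective⟩, ?_⟩
  have : Set.range (fun g : SLR n => (g : Matrix (Fin n) (Fin n) ℝ)) = {A | A.det = 1} := by
    ext A
    exact ⟨fun ⟨g, hg⟩ => hg ▸ g.2, fun h => ⟨⟨A, h⟩, rfl⟩⟩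
  rw [this]
  exact isClosed_eq (Continuous.matrix_det continuous_id) continuous_const

instance (n : ℕ) : PolishSpace (Matrix (Fin n) (Fin n) ℝ) :=
  inferInstanceAs (PolishSpace (Fin n → Fin n → ℝ))

instance (n : ℕ) : PolishSpace (SLR n) := (SLR.isClosedEmbedding_coe n).polishSpace

instance (n : ℕ) : MeasurableSpace (SLR n) := borel _

instance (n : ℕ) : BorelSpace (SLR n) := ⟨rfl⟩

instance (n : ℕ) : BorelSpace (LatticeSpace n) := ⟨rfl⟩

theorem mem_SLZ_iff {n : ℕ} {g : SLR n} :
    g ∈ SLZ n ↔ ∃ γ : Matrix.SpecialLinearGroup (Fin n) ℤ, ∀ i j, (γ.1 i j : ℝ) = g.1 i j := by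
  refine exists_congr fun γ => ⟨fun h i j => ?_, fun h => ?_⟩
  · rw [← h]; simp
  · ext i j; simpa using h i j

theorem isClosed_SLZ (n : ℕ) : IsClosed (SLZ n : Set (SLR n)) := by
  have : (SLZ n : Set (SLR n)) = ⋂ i, ⋂ j, (fun g : SLR n => g.1 i j) ⁻¹'
      Set.range ((↑) : ℤ → ℝ) := by
    ext g
    simp only [SetLike.mem_coe, mem_SLZ_iff, Set.mem_iInter, Set.mem_preimage, Set.mem_range]
    constructor
    · rintro ⟨γ, h⟩ i j
      exact ⟨_, h i j⟩
    · intro h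
      choose A hA using h
      have hA' : (Matrix.of A).map (Int.castRingHom ℝ) = g.1 := by ext i j; simp [hA]
      refine ⟨⟨Matrix.of A, ?_⟩, hA⟩
      have := g.2
      rw [← hA', ← RingHom.mapMatrix_apply, ← RingHom.map_det] at this
      simpa using this
  rw [this]
  refine isClosed_iInter fun i => isClosed_iInter fun j => ?_
  refine Int.isClosedEmbedding_coe_real.isClosed_range.preimage ?_
  exact (SLR.continuous_coe n).matrix_elem i j

instance (n : ℕ) : T1Space (LatticeSpace n) :=
  haveI := isClosed_SLZ n
  inferInstanceAs (T1Space (SLR n ⧸ SLZ n))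

instance (n : ℕ) : SecondCountableTopology (LatticeSpace n) :=
  inferInstanceAs (SecondCountableTopology (SLR n ⧸ SLZ n))

/-- The point of the space of lattices represented by a matrix. -/
def LatticeSpace.mk {n : ℕ} (g : SLR n) : LatticeSpace n := (QuotientGroup.mk g : SLR n ⧸ SLZ n)

theorem LatticeSpace.continuous_mk (n : ℕ) : Continuous (LatticeSpace.mk (n := n)) :=
  QuotientGroup.continuous_mk

theorem LatticeSpace.surjective_mk (n : ℕ) : Function.Surjective (LatticeSpace.mk (n := n)) :=
  QuotientGroup.mk_surjective

theorem LatticeSpace.smul_mk {n : ℕ} (h g : SLR n) :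
    h • LatticeSpace.mk g = LatticeSpace.mk (h * g) := rfl

theorem LatticeSpace.measurable_iff {n : ℕ} {β : Type*} [MeasurableSpace β]
    {f : LatticeSpace n → β} : Measurable f ↔ Measurable fun g : SLR n => f (LatticeSpace.mk g) :=
  ((LatticeSpace.continuous_mk n).measurable.measurable_comp_iff_of_surjective
    (LatticeSpace.surjective_mk n)).symm

instance (n : ℕ) : ContinuousSMul (SLR n) (LatticeSpace n) :=
  inferInstanceAs (ContinuousSMul (SLR n) (SLR n ⧸ SLZ n))

/-- The image of a tuple of integer vectors under a matrix. -/
def latticeTuple {m n : ℕ} (g : SLR n) (V : Fin m → Fin n → ℤ) : Fin m → Fin n → ℝ :=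
  fun j => g.1.mulVec fun i => (V j i : ℝ)

/-- The number of tuples in `g • 𝒱` lying in `A`, as a function of the lattice `g ℤⁿ`. -/
def tupleCount {m n : ℕ} (𝒱 : Set (Fin m → Fin n → ℤ)) (A : Set (Fin m → Fin n → ℝ))
    (L : LatticeSpace n) : ℝ≥0∞ :=
  ∑' V : 𝒱, A.indicator 1 (latticeTuple (Quotient.out (α := SLR n) L) V.1)

/-- Invariance of a set of tuples of integer vectors under unimodular matrices. -/
def UnimodularInvariant {m n : ℕ} (𝒱 : Set (Fin m → Fin n → ℤ)) : Prop :=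
  ∀ γ : Matrix.SpecialLinearGroup (Fin n) ℤ, ∀ V ∈ 𝒱, (fun j => γ.1.mulVec (V j)) ∈ 𝒱

theorem tupleCount_mk {m n : ℕ} {𝒱 : Set (Fin m → Fin n → ℤ)} (h𝒱 : UnimodularInvariant 𝒱)
    (A : Set (Fin m → Fin n → ℝ)) (g : SLR n) :
    tupleCount 𝒱 A (LatticeSpace.mk g) = ∑' V : 𝒱, A.indicator 1 (latticeTuple g V.1) := by
  obtain ⟨γ, hγ⟩ : ∃ γ : Matrix.SpecialLinearGroup (Fin n) ℤ,
      Quotient.out (α := SLR n) (LatticeSpace.mk g) =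
        g * Matrix.SpecialLinearGroup.map (Int.castRingHom ℝ) γ := by
    obtain ⟨⟨h, γ, rfl⟩, hh⟩ := QuotientGroup.mk_out_eq_mul (SLZ n) g
    exact ⟨γ, hh⟩
  have hmul : ∀ (γ : Matrix.SpecialLinearGroup (Fin n) ℤ) (V : Fin m → Fin n → ℤ),
      latticeTuple (g * Matrix.SpecialLinearGroup.map (Int.castRingHom ℝ) γ) V =
        latticeTuple g fun j => γ.1.mulVec (V j) := by
    intro γ V
    funext j
    simp only [latticeTuple, Matrix.SpecialLinearGroup.coe_mul, ← Matrix.mulVec_mulVec]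
    congr 1
    ext i
    simp [Matrix.mulVec, dotProduct]
  have hinvl : ∀ (γ : Matrix.SpecialLinearGroup (Fin n) ℤ) (v : Fin n → ℤ),
      γ.1.mulVec (γ⁻¹.1.mulVec v) = v := by
    intro γ v
    rw [Matrix.mulVec_mulVec, ← Matrix.SpecialLinearGroup.coe_mul, mul_inv_cancel]
    simp
  let e : 𝒱 ≃ 𝒱 :=
    { toFun := fun V => ⟨_, h𝒱 γ V.1 V.2⟩
      invFun := fun V => ⟨_, h𝒱 γ⁻¹ V.1 V.2⟩
      left_inv := fun V => by
        ext1; funext j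
        simpa using hinvl γ⁻¹ (V.1 j)
      right_inv := fun V => by
        ext1; funext j
        exact hinvl γ (V.1 j) }
  rw [tupleCount, hγ, ← e.tsum_eq fun V : 𝒱 => A.indicator 1 (latticeTuple g V.1)]
  exact tsum_congr fun V => by rw [hmul]; rfl

theorem measurable_latticeTuple {m n : ℕ} (V : Fin m → Fin n → ℤ) :
    Measurable fun g : SLR n => latticeTuple g V := by
  refine Continuous.measurable (continuous_pi fun j => ?_)
  exact (SLR.continuous_coe n).matrix_mulVec continuous_const

theorem measurable_tupleCount {m n : ℕ} {𝒱 : Set (Fin m → Fin n → ℤ)}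
    (h𝒱 : UnimodularInvariant 𝒱) {A : Set (Fin m → Fin n → ℝ)} (hA : MeasurableSet A) :
    Measurable (tupleCount 𝒱 A) := by
  rw [LatticeSpace.measurable_iff]
  simp_rw [tupleCount_mk h𝒱]
  exact Measurable.tsum fun V =>
    (measurable_one.indicator hA).comp (measurable_latticeTuple V.1)

/-- The intensity measure of the point process of tuples of lattice vectors of type `𝒱`. -/
def intensity {m n : ℕ} (𝒱 : Set (Fin m → Fin n → ℤ)) (μ : Measure (LatticeSpace n)) :
    Measure (Fin m → Fin n → ℝ) :=
  μ.bind fun L => Measure.sum fun V : 𝒱 =>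
    Measure.dirac (latticeTuple (Quotient.out (α := SLR n) L) V.1)

theorem sum_dirac_apply {m n : ℕ} (𝒱 : Set (Fin m → Fin n → ℤ)) {A : Set (Fin m → Fin n → ℝ)}
    (hA : MeasurableSet A) (L : LatticeSpace n) :
    Measure.sum (fun V : 𝒱 => Measure.dirac (latticeTuple (Quotient.out (α := SLR n) L) V.1)) A =
      tupleCount 𝒱 A L := by
  rw [Measure.sum_apply _ hA, tupleCount]
  exact tsum_congr fun V => by rw [Measure.dirac_apply' _ hA]

theorem intensity_apply {m n : ℕ} {𝒱 : Set (Fin m → Fin n → ℤ)} (h𝒱 : UnimodularInvariant 𝒱)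
    (μ : Measure (LatticeSpace n)) {A : Set (Fin m → Fin n → ℝ)} (hA : MeasurableSet A) :
    intensity 𝒱 μ A = ∫⁻ L, tupleCount 𝒱 A L ∂μ := by
  rw [intensity, Measure.bind_apply hA]
  · exact lintegral_congr fun L => sum_dirac_apply 𝒱 hA L
  · refine (Measure.measurable_of_measurable_coe _ fun B hB => ?_).aemeasurable
    simp_rw [sum_dirac_apply 𝒱 hB]
    exact measurable_tupleCount h𝒱 hB

theorem tupleCount_smul {m n : ℕ} {𝒱 : Set (Fin m → Fin n → ℤ)} (h𝒱 : UnimodularInvariant 𝒱)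
    (A : Set (Fin m → Fin n → ℝ)) (h : SLR n) (L : LatticeSpace n) :
    tupleCount 𝒱 A (h • L) = tupleCount 𝒱 {x | (fun j => h.1.mulVec (x j)) ∈ A} L := by
  obtain ⟨g, rfl⟩ := LatticeSpace.surjective_mk n L
  rw [LatticeSpace.smul_mk, tupleCount_mk h𝒱, tupleCount_mk h𝒱]
  refine tsum_congr fun V => ?_
  have : latticeTuple (h * g) V.1 = fun j => h.1.mulVec (latticeTuple g V.1 j) := by
    funext j
    simp [latticeTuple]
  rw [this]
  rfl

theorem lintegral_lattice_smul {n : ℕ} {μ : Measure (LatticeSpace n)}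
    (hinv : ∀ g : SLR n, Measure.map (fun x => g • x) μ = μ) {f : LatticeSpace n → ℝ≥0∞}
    (hf : Measurable f) (h : SLR n) : ∫⁻ L, f (h • L) ∂μ = ∫⁻ L, f L ∂μ := by
  conv_rhs => rw [← hinv h]
  exact (lintegral_map hf (continuous_const_smul h).measurable).symm

theorem intensity_preimage {m n : ℕ} {𝒱 : Set (Fin m → Fin n → ℤ)} (h𝒱 : UnimodularInvariant 𝒱)
    {μ : Measure (LatticeSpace n)} (hinv : ∀ g : SLR n, Measure.map (fun x => g • x) μ = μ)
    {A : Set (Fin m → Fin n → ℝ)} (hA : MeasurableSet A) (h : SLR n) :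
    intensity 𝒱 μ {x | (fun j => h.1.mulVec (x j)) ∈ A} = intensity 𝒱 μ A := by
  have hm : Measurable fun x : Fin m → Fin n → ℝ => fun j => h.1.mulVec (x j) :=
    (continuous_pi fun j => continuous_const.matrix_mulVec (continuous_apply j)).measurable
  have hB : MeasurableSet {x : Fin m → Fin n → ℝ | (fun j => h.1.mulVec (x j)) ∈ A} := hm hA
  rw [intensity_apply h𝒱 μ hA, intensity_apply h𝒱 μ hB,
    ← lintegral_lattice_smul hinv (measurable_tupleCount h𝒱 hA) h]
  exact lintegral_congr fun L => (tupleCount_smul h𝒱 A h L).symm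

theorem volume_preimage_mulVec {m n : ℕ} (h : SLR n) {A : Set (Fin m → Fin n → ℝ)}
    (hA : MeasurableSet A) :
    volume {x : Fin m → Fin n → ℝ | (fun j => h.1.mulVec (x j)) ∈ A} = volume A := by
  have h1 : MeasurePreserving (fun v : Fin n → ℝ => h.1.mulVec v) volume volume := by
    refine ⟨(continuous_const.matrix_mulVec continuous_id).measurable, ?_⟩
    have := Real.map_matrix_volume_pi_eq_smul_volume_pi (M := h.1) (by simp)
    rw [h.2, inv_one, abs_one, ENNReal.ofReal_one, one_smul] at this
    exact this
  exact (volume_preserving_pi fun _ : Fin m => h1).measure_preimage hA.nullMeasurableSet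

/-- Translates of some bounded measurable set of volume `D` by the elements of `𝒱` are pairwise
disjoint. -/
def HasPacking {m n : ℕ} (𝒱 : Set (Fin m → Fin n → ℤ)) (D : ℝ≥0∞) : Prop :=
  ∃ P : Set (Fin m → Fin n → ℝ), MeasurableSet P ∧ Bornology.IsBounded P ∧ volume P = D ∧
    ∀ V ∈ 𝒱, ∀ W ∈ 𝒱, ∀ x ∈ P, ∀ y ∈ P,
      (∀ j i, (V j i : ℝ) + x j i = W j i + y j i) → V = W

theorem volume_Icc_tuple {m n : ℕ} (a b : Fin m → Fin n → ℝ) :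
    volume (Set.Icc a b) = ∏ j, ∏ i, ENNReal.ofReal (b j i - a j i) := by
  rw [← Set.pi_univ_Icc, volume_pi_pi]
  simp [Real.volume_Icc_pi]

theorem HasPacking.tsum_indicator_mul_le {m n : ℕ} {𝒱 : Set (Fin m → Fin n → ℤ)} {D : ℝ≥0∞}
    (h𝒱 : HasPacking 𝒱 D) (g : SLR n) :
    ∃ R : ℝ, 0 ≤ R ∧ ∀ a b : Fin m → Fin n → ℝ,
      (∑' V : 𝒱, (Set.Icc a b).indicator 1 (latticeTuple g V.1)) * D ≤
        ∏ j, ∏ i, ENNReal.ofReal (b j i - a j i + 2 * R) := by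
  obtain ⟨P, mP, bP, vP, hP⟩ := h𝒱
  have hc : Continuous fun x : Fin m → Fin n → ℝ => fun j => g.1.mulVec (x j) :=
    continuous_pi fun j => continuous_const.matrix_mulVec (continuous_apply j)
  obtain ⟨R, hR⟩ := ((bP.isCompact_closure.image hc).isBounded).subset_closedBall 0
  refine ⟨max R 0, le_max_right _ _, fun a b => ?_⟩
  have hRP : ∀ x ∈ P, ∀ j i, |g.1.mulVec (x j) i| ≤ max R 0 := by
    intro x hx j i
    have h1 := hR (Set.mem_image_of_mem _ (subset_closure hx))
    rw [mem_closedBall_zero_iff] at h1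
    have h2 := (norm_le_pi_norm (fun j => g.1.mulVec (x j)) j).trans h1
    exact ((norm_le_pi_norm (g.1.mulVec (x j)) i).trans h2).trans (le_max_left _ _)
  set R' := max R 0
  let T : 𝒱 → Set (Fin m → Fin n → ℝ) := fun V =>
    (fun x => (fun j i => -(V.1 j i : ℝ)) + x) ⁻¹' P
  have mT : ∀ V, MeasurableSet (T V) := fun V => (measurable_const_add _) mP
  have vT : ∀ V, volume (T V) = D := fun V => (measure_preimage_add _ _ _).trans vP
  let J : Set 𝒱 := {V | latticeTuple g V.1 ∈ Set.Icc a b}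
  have hdisj : Pairwise (Function.onFun Disjoint fun V : J => T V.1) := by
    intro V W hVW
    refine Set.disjoint_left.2 fun x hx hy => hVW ?_
    refine Subtype.ext (Subtype.ext (hP _ V.1.2 _ W.1.2 _ hx _ hy fun j i => ?_))
    simp
  have hsub : ⋃ V : J, T V.1 ⊆ {x | (fun j => g.1.mulVec (x j)) ∈
      Set.Icc (fun j i => a j i - R') (fun j i => b j i + R')} := by
    refine Set.iUnion_subset fun V x hx => ?_
    have hV : latticeTuple g V.1.1 ∈ Set.Icc a b := V.2
    have h1 : ∀ j i, g.1.mulVec (x j) i = latticeTuple g V.1.1 j i +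
        g.1.mulVec (((fun j i => -(V.1.1 j i : ℝ)) + x) j) i := by
      intro j i
      rw [latticeTuple, ← Pi.add_apply (g.1.mulVec _) (g.1.mulVec _), ← Matrix.mulVec_add]
      congr 2
      ext l
      simp
    have h2 := hRP _ hx
    constructor
    · intro j i
      have := hV.1 j i
      have := (abs_le.1 (h2 j i)).1
      have := h1 j i
      dsimp only
      linarith
    · intro j i
      have := hV.2 j i
      have := (abs_le.1 (h2 j i)).2
      have := h1 j i
      dsimp only
      linarith
  calc (∑' V : 𝒱, (Set.Icc a b).indicator 1 (latticeTuple g V.1)) * D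
      = ∑' V : J, volume (T V.1) := by
        rw [← ENNReal.tsum_mul_right, tsum_subtype J fun V => volume (T V)]
        refine tsum_congr fun V => ?_
        by_cases hV : V ∈ J
        · rw [Set.indicator_of_mem hV, Set.indicator_of_mem (show latticeTuple g V.1 ∈ _ from hV),
            vT, Pi.one_apply, one_mul]
        · rw [Set.indicator_of_notMem hV,
            Set.indicator_of_notMem (show latticeTuple g V.1 ∉ _ from hV), zero_mul]
    _ = volume (⋃ V : J, T V.1) := (measure_iUnion hdisj fun V => mT V.1).symm
    _ ≤ _ := measure_mono hsub
    _ = volume (Set.Icc (fun j i => a j i - R') (fun j i => b j i + R')) :=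
        volume_preimage_mulVec g measurableSet_Icc
    _ = _ := by
        rw [volume_Icc_tuple]
        refine Finset.prod_congr rfl fun j _ => Finset.prod_congr rfl fun i _ => ?_
        congr 1
        ring

/-- The block matrix `[[t, t B], [0, s]]`. -/
def shear {p m : ℕ} (t s : ℝ) (hts : t ^ p * s ^ m = 1) (B : Fin p → Fin m → ℝ) : SLR (p + m) :=
  ⟨Matrix.reindex finSumFinEquiv finSumFinEquiv
    (Matrix.fromBlocks (t • 1) (t • Matrix.of B) 0 (s • 1)), by
      rw [Matrix.det_reindex_self, Matrix.det_fromBlocks_zero₂₁]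
      simpa using hts⟩

theorem shear_mulVec_castAdd {p m : ℕ} (t s : ℝ) (hts : t ^ p * s ^ m = 1)
    (B : Fin p → Fin m → ℝ) (v : Fin (p + m) → ℝ) (i : Fin p) :
    (shear t s hts B).1.mulVec v (Fin.castAdd m i) =
      t * (v (Fin.castAdd m i) + ∑ l, B i l * v (Fin.natAdd p l)) := by
  simp [shear, Matrix.mulVec, dotProduct, Fin.sum_univ_add, Matrix.one_apply, Finset.mul_sum,
    mul_add, mul_assoc]

theorem shear_mulVec_natAdd {p m : ℕ} (t s : ℝ) (hts : t ^ p * s ^ m = 1)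
    (B : Fin p → Fin m → ℝ) (v : Fin (p + m) → ℝ) (l : Fin m) :
    (shear t s hts B).1.mulVec v (Fin.natAdd p l) = s * v (Fin.natAdd p l) := by
  simp [shear, Matrix.mulVec, dotProduct, Fin.sum_univ_add, Matrix.one_apply]

theorem continuous_shear {p m : ℕ} (t s : ℝ) (hts : t ^ p * s ^ m = 1) :
    Continuous (shear (p := p) (m := m) t s hts) := by
  refine continuous_induced_rng.2 ?_
  refine Continuous.matrix_reindex ?_ _ _
  refine Continuous.matrix_fromBlocks continuous_const ?_ continuous_const continuous_const
  exact (continuous_id : Continuous fun B : Fin p → Fin m → ℝ => B).const_smul t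

theorem volume_affine_rows {p m : ℕ} {t δ : ℝ} (ht : 0 < t) (hδ : 0 ≤ δ)
    (M : Matrix (Fin m) (Fin m) ℝ) (hM : M.det ≠ 0) (x c : Fin p → Fin m → ℝ) :
    volume {B : Fin p → Fin m → ℝ | ∀ i j, |t * (x i j + ∑ l, B i l * M l j) - c i j| ≤ δ} =
      ENNReal.ofReal ((2 * δ) ^ m / (t ^ m * |M.det|)) ^ p := by
  have row : ∀ i, volume {β : Fin m → ℝ | ∀ j, |t * (x i j + ∑ l, β l * M l j) - c i j| ≤ δ} =
      ENNReal.ofReal ((2 * δ) ^ m / (t ^ m * |M.det|)) := by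
    intro i
    have hdet : LinearMap.det (Matrix.toLin' (t • M.transpose)) = t ^ m * M.det := by
      rw [LinearMap.det_toLin', Matrix.det_smul, Matrix.det_transpose, Fintype.card_fin]
    have hne : t ^ m * M.det ≠ 0 := mul_ne_zero (pow_pos ht m).ne' hM
    have hset : {β : Fin m → ℝ | ∀ j, |t * (x i j + ∑ l, β l * M l j) - c i j| ≤ δ} =
        Matrix.toLin' (t • M.transpose) ⁻¹'
          Set.Icc (fun j => c i j - t * x i j - δ) (fun j => c i j - t * x i j + δ) := by
      ext β
      have h1 : ∀ j, Matrix.toLin' (t • M.transpose) β j = t * ∑ l, β l * M l j := by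
        intro j
        simp only [map_smul, LinearMap.smul_apply, Matrix.toLin'_apply, Pi.smul_apply, smul_eq_mul,
          Matrix.mulVec, dotProduct, Matrix.transpose_apply]
        congr 1
        exact Finset.sum_congr rfl fun l _ => mul_comm _ _
      simp only [Set.mem_ofPred_eq, Set.mem_preimage, Set.mem_Icc, Pi.le_def, h1, abs_le,
        ← forall_and]
      refine forall_congr' fun j => ?_
      constructor <;> rintro ⟨h2, h3⟩ <;> constructor <;> linarith
    rw [hset, Measure.addHaar_preimage_linearMap _ (by rwa [hdet]), Real.volume_Icc_pi, hdet]
    have : ∀ j, c i j - t * x i j + δ - (c i j - t * x i j - δ) = 2 * δ := fun j => by ring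
    simp only [this, Finset.prod_const, Finset.card_univ, Fintype.card_fin]
    rw [← ENNReal.ofReal_pow (by positivity), ← ENNReal.ofReal_mul (abs_nonneg _), abs_inv, abs_mul,
      abs_of_pos (pow_pos ht m), mul_comm, div_eq_mul_inv]
  have hset : {B : Fin p → Fin m → ℝ | ∀ i j, |t * (x i j + ∑ l, B i l * M l j) - c i j| ≤ δ} =
      Set.univ.pi fun i => {β : Fin m → ℝ | ∀ j, |t * (x i j + ∑ l, β l * M l j) - c i j| ≤ δ} := by
    ext B; simp
  rw [hset, volume_pi_pi]
  simp [row]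

/-- The tuple whose vectors are the last `m` standard basis vectors of `ℝ^(p+m)`. -/
def baseTuple (p m : ℕ) : Fin m → Fin (p + m) → ℝ := fun j => Fin.append 0 (Pi.single j 1)

/-- The square matrix formed by the last `m` coordinates of a tuple. -/
def lowerBlock {p m : ℕ} (W : Fin m → Fin (p + m) → ℝ) : Matrix (Fin m) (Fin m) ℝ :=
  Matrix.of fun l j => W j (Fin.natAdd p l)

theorem exists_radius_det (p m : ℕ) {C : ℝ} (hC : 1 < C) :
    ∃ ε : ℝ, 0 < ε ∧ ∀ W : Fin m → Fin (p + m) → ℝ, (∀ j i, |W j i - baseTuple p m j i| ≤ ε) →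
      (1 + (m + 1) * ε) ^ (p * m) < C * |(lowerBlock W).det| ^ p := by
  let F : ℝ × (Fin m → Fin (p + m) → ℝ) → ℝ := fun x =>
    C * |(lowerBlock x.2).det| ^ p - (1 + (m + 1) * x.1) ^ (p * m)
  have hl : Continuous fun x : ℝ × (Fin m → Fin (p + m) → ℝ) => lowerBlock x.2 :=
    continuous_matrix fun l j => by
      simp only [lowerBlock, Matrix.of_apply]
      fun_prop
  have hF : Continuous F := by
    have := hl.matrix_det
    fun_prop
  have h0 : lowerBlock (baseTuple p m) = 1 := by
    ext l j
    simp [lowerBlock, baseTuple, Matrix.one_apply, Pi.single_apply]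
  have hpos : 0 < F (0, baseTuple p m) := by
    simp only [F, h0]
    simpa using hC
  obtain ⟨η, hη, hball⟩ := Metric.mem_nhds_iff.1 ((hF.tendsto _).eventually_const_lt hpos)
  refine ⟨η / 2, half_pos hη, fun W hW => ?_⟩
  have : ((η / 2, W) : ℝ × _) ∈ Metric.ball ((0 : ℝ), baseTuple p m) η := by
    rw [Metric.mem_ball, Prod.dist_eq, max_lt_iff]
    refine ⟨by rw [Real.dist_eq, sub_zero, abs_of_pos (half_pos hη)]; linarith, ?_⟩
    refine lt_of_le_of_lt ?_ (half_lt_self hη)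
    refine (dist_pi_le_iff (half_pos hη).le).2 fun j => (dist_pi_le_iff (half_pos hη).le).2 fun i =>
      ?_
    exact hW j i
  exact sub_pos.1 (hball this)

theorem mem_closedBall_tuple {m n : ℕ} {δ : ℝ} (hδ : 0 ≤ δ) {x c : Fin m → Fin n → ℝ} :
    x ∈ Metric.closedBall c δ ↔ ∀ j i, |x j i - c j i| ≤ δ := by
  simp only [Metric.mem_closedBall, dist_pi_le_iff hδ, Real.dist_eq]

theorem lintegral_shear_indicator_le {p m : ℕ} (hp : p ≠ 0) {t r : ℝ} (ht : 0 < t) (hr : 0 < r)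
    (htr : 1 ≤ t * r) (hts : t ^ p * r⁻¹ ^ m = 1) {C ε δ : ℝ} (hC : 1 < C) (hε : 0 < ε)
    (hdet : ∀ W : Fin m → Fin (p + m) → ℝ, (∀ j i, |W j i - baseTuple p m j i| ≤ ε) →
      (1 + (m + 1) * ε) ^ (p * m) < C * |(lowerBlock W).det| ^ p)
    (hδ : 0 ≤ δ) {c : Fin m → Fin (p + m) → ℝ}
    (hc : ∀ j i, |c j i - baseTuple p m j i| + δ ≤ ε) (W : Fin m → Fin (p + m) → ℝ) :
    ∫⁻ B in Set.Icc (-1 : Fin p → Fin m → ℝ) 1,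
        (Metric.closedBall c δ).indicator 1 (fun j => (shear t r⁻¹ hts B).1.mulVec (W j)) ≤
      ENNReal.ofReal (((2 * δ) ^ m * r⁻¹ ^ m / t ^ m) ^ p * (C / (1 + (m + 1) * ε) ^ (p * m))) *
        (Set.Icc (fun j => Fin.append (fun _ : Fin p => -(r * (1 + (m + 1) * ε)))
            fun l => r * (c j (Fin.natAdd p l) - δ))
          (fun j => Fin.append (fun _ : Fin p => r * (1 + (m + 1) * ε))
            fun l => r * (c j (Fin.natAdd p l) + δ))).indicator 1 W := by
  have hmem : ∀ B, (fun j => (shear t r⁻¹ hts B).1.mulVec (W j)) ∈ Metric.closedBall c δ ↔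
      (∀ j i, |t * (W j (Fin.castAdd m i) + ∑ l, B i l * W j (Fin.natAdd p l)) -
        c j (Fin.castAdd m i)| ≤ δ) ∧
      ∀ j l, |r⁻¹ * W j (Fin.natAdd p l) - c j (Fin.natAdd p l)| ≤ δ := by
    intro B
    rw [mem_closedBall_tuple hδ]
    simp_rw [Fin.forall_fin_add, shear_mulVec_castAdd, shear_mulVec_natAdd, forall_and]
  by_cases hlow : ∀ j l, |r⁻¹ * W j (Fin.natAdd p l) - c j (Fin.natAdd p l)| ≤ δ
  swap
  · refine le_of_eq_of_le ?_ zero_le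
    have : ∀ B, (Metric.closedBall c δ).indicator (1 : (Fin m → Fin (p + m) → ℝ) → ℝ≥0∞)
        (fun j => (shear t r⁻¹ hts B).1.mulVec (W j)) = 0 := fun B =>
      Set.indicator_of_notMem (fun h => hlow ((hmem B).1 h).2) _
    simp [this]
  have hbase : ∀ j i, |baseTuple p m j i| ≤ 1 := by
    intro j i
    refine Fin.addCases (fun i => ?_) (fun l => ?_) i
    · simp [baseTuple]
    · simp only [baseTuple, Fin.append_right, Pi.single_apply]
      split_ifs <;> simp
  have hlow' : ∀ j l, |r⁻¹ * W j (Fin.natAdd p l) - baseTuple p m j (Fin.natAdd p l)| ≤ ε := by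
    intro j l
    have := abs_sub_le (r⁻¹ * W j (Fin.natAdd p l)) (c j (Fin.natAdd p l))
      (baseTuple p m j (Fin.natAdd p l))
    linarith [hlow j l, hc j (Fin.natAdd p l)]
  by_cases hup : ∀ j i, |W j (Fin.castAdd m i)| ≤ r * (1 + (m + 1) * ε)
  · rw [Set.indicator_of_mem (s := Set.Icc _ _), Pi.one_apply, mul_one]
    · set d := (lowerBlock W).det with hd
      have h1 : (1 + (m + 1) * ε) ^ (p * m) < C * (r⁻¹ ^ m * |d|) ^ p := by
        have := hdet (fun j => Fin.append 0 fun l => r⁻¹ * W j (Fin.natAdd p l)) (by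
          intro j i
          refine Fin.addCases (fun i => ?_) (fun l => ?_) i
          · simpa [baseTuple] using hε.le
          · simpa using hlow' j l)
        have hlb : lowerBlock (fun j => Fin.append (0 : Fin p → ℝ)
            fun l => r⁻¹ * W j (Fin.natAdd p l)) = r⁻¹ • lowerBlock W := by
          ext l j
          simp [lowerBlock]
        rw [hlb, Matrix.det_smul, Fintype.card_fin, abs_mul, abs_of_pos (by positivity)] at this
        exact this
      have hA : 0 < (1 + (m + 1) * ε) ^ (p * m) := by positivity
      have h2 : 0 < (r⁻¹ ^ m * |d|) ^ p := by
        by_contra h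
        nlinarith [show 0 ≤ (r⁻¹ ^ m * |d|) ^ p by positivity]
      have hd0 : d ≠ 0 := by
        rintro h
        simp [h, hp] at h2
      calc _ ≤ ∫⁻ B : Fin p → Fin m → ℝ, {B | ∀ i j, |t * (W j (Fin.castAdd m i) +
              ∑ l, B i l * lowerBlock W l j) - c j (Fin.castAdd m i)| ≤ δ}.indicator 1 B := by
            refine (setLIntegral_le_lintegral _ _).trans (lintegral_mono fun B => ?_)
            by_cases hB : (fun j => (shear t r⁻¹ hts B).1.mulVec (W j)) ∈ Metric.closedBall c δ
            · rw [Set.indicator_of_mem hB, Set.indicator_of_mem]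
              · rfl
              · exact fun i j => ((hmem B).1 hB).1 j i
            · rw [Set.indicator_of_notMem hB]
              exact zero_le
        _ ≤ _ := lintegral_indicator_one_le _
        _ = _ := volume_affine_rows ht hδ _ hd0 (fun i j => W j (Fin.castAdd m i))
            (fun i j => c j (Fin.castAdd m i))
        _ ≤ _ := by
            rw [← ENNReal.ofReal_pow (by positivity)]
            refine ENNReal.ofReal_le_ofReal ?_
            have hd' : 0 < |d| := abs_pos.2 hd0
            have : C / (1 + (m + 1) * ε) ^ (p * m) ≥ 1 / (r⁻¹ ^ m * |d|) ^ p := by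
              rw [ge_iff_le, div_le_div_iff₀ h2 hA]
              linarith
            calc ((2 * δ) ^ m / (t ^ m * |d|)) ^ p
                = ((2 * δ) ^ m * r⁻¹ ^ m / t ^ m) ^ p * (1 / (r⁻¹ ^ m * |d|) ^ p) := by
                  rw [← one_div_pow, ← mul_pow]
                  congr 1
                  have : r⁻¹ ^ m ≠ 0 := by positivity
                  field_simp
              _ ≤ _ := by gcongr
    · have hr' : ∀ x : ℝ, r * (r⁻¹ * x) = x := fun x => mul_inv_cancel_left₀ hr.ne' x
      constructor
      · intro j i
        refine Fin.addCases (fun i => ?_) (fun l => ?_) i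
        · simpa using (abs_le.1 (hup j i)).1
        · beta_reduce
          rw [Fin.append_right, ← hr' (W j _)]
          have := (abs_le.1 (hlow j l)).1
          exact mul_le_mul_of_nonneg_left (by linarith) hr.le
      · intro j i
        refine Fin.addCases (fun i => ?_) (fun l => ?_) i
        · simpa using (abs_le.1 (hup j i)).2
        · beta_reduce
          rw [Fin.append_right, ← hr' (W j _)]
          have := (abs_le.1 (hlow j l)).2
          exact mul_le_mul_of_nonneg_left (by linarith) hr.le
  · refine le_of_eq_of_le ?_ zero_le
    rw [setLIntegral_congr_fun (g := fun _ => 0) measurableSet_Icc, lintegral_zero]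
    intro B hB
    refine Set.indicator_of_notMem (fun h => hup fun j i => ?_) _
    have h1 := ((hmem B).1 h).1 j i
    have hBi : ∀ l, |B i l| ≤ 1 := fun l => abs_le.2 ⟨hB.1 i l, hB.2 i l⟩
    have hW : ∀ l, |W j (Fin.natAdd p l)| ≤ r * (ε + |baseTuple p m j (Fin.natAdd p l)|) := by
      intro l
      rw [← mul_inv_cancel_left₀ hr.ne' (W j (Fin.natAdd p l)), abs_mul, abs_of_pos hr]
      refine mul_le_mul_of_nonneg_left ?_ hr.le
      have := abs_sub_abs_le_abs_sub (r⁻¹ * W j (Fin.natAdd p l))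
        (baseTuple p m j (Fin.natAdd p l))
      linarith [hlow' j l]
    have hsum : |∑ l, B i l * W j (Fin.natAdd p l)| ≤ r * (m * ε + 1) := by
      calc _ ≤ ∑ l, |B i l * W j (Fin.natAdd p l)| := Finset.abs_sum_le_sum_abs _ _
        _ ≤ ∑ l, r * (ε + |baseTuple p m j (Fin.natAdd p l)|) := by
            refine Finset.sum_le_sum fun l _ => ?_
            rw [abs_mul]
            exact (mul_le_of_le_one_left (abs_nonneg _) (hBi l)).trans (hW l)
        _ = _ := by
            rw [← Finset.mul_sum, Finset.sum_add_distrib]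
            simp [baseTuple, Pi.single_apply, apply_ite abs]
    have hc0 : |c j (Fin.castAdd m i)| + δ ≤ ε := by
      simpa [baseTuple] using hc j (Fin.castAdd m i)
    have h2 : |t * (W j (Fin.castAdd m i) + ∑ l, B i l * W j (Fin.natAdd p l))| ≤ ε := by
      have := abs_sub_abs_le_abs_sub (t * (W j (Fin.castAdd m i) +
        ∑ l, B i l * W j (Fin.natAdd p l))) (c j (Fin.castAdd m i))
      linarith
    rw [abs_mul, abs_of_pos ht] at h2
    have h3 : |W j (Fin.castAdd m i) + ∑ l, B i l * W j (Fin.natAdd p l)| ≤ r * ε := by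
      refine le_of_mul_le_mul_left (h2.trans ?_) ht
      nlinarith
    have h4 := abs_sub (W j (Fin.castAdd m i) + ∑ l, B i l * W j (Fin.natAdd p l))
      (∑ l, B i l * W j (Fin.natAdd p l))
    rw [add_sub_cancel_right] at h4
    linarith

theorem volume_closedBall_tuple {m n : ℕ} {δ : ℝ} (hδ : 0 ≤ δ) (c : Fin m → Fin n → ℝ) :
    volume (Metric.closedBall c δ) = ENNReal.ofReal ((2 * δ) ^ (n * m)) := by
  have : Metric.closedBall c δ = Set.Icc (fun j i => c j i - δ) fun j i => c j i + δ := by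
    ext x
    simp only [mem_closedBall_tuple hδ, Set.mem_Icc, Pi.le_def, abs_le, ← forall_and]
    refine forall_congr' fun j => forall_congr' fun i => ?_
    constructor <;> rintro ⟨h2, h3⟩ <;> constructor <;> linarith
  rw [this, volume_Icc_tuple]
  have : ∀ j i, c j i + δ - (c j i - δ) = 2 * δ := fun j i => by ring
  simp only [this, Finset.prod_const, Finset.card_univ, Fintype.card_fin]
  rw [← pow_mul, ENNReal.ofReal_pow (by positivity)]

theorem shear_scale_eq_one (p m N : ℕ) :
    (((N : ℝ) + 1) ^ m) ^ p * ((((N : ℝ) + 1) ^ p)⁻¹) ^ m = 1 := by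
  rw [inv_pow, ← pow_mul, ← pow_mul, mul_comm m p]
  exact mul_inv_cancel₀ (by positivity)

/-- A sequence of shears, contracting the last `m` coordinates more and more. -/
def shearSeq {p m : ℕ} (N : ℕ) (B : Fin p → Fin m → ℝ) : SLR (p + m) :=
  shear _ _ (shear_scale_eq_one p m N) B

theorem setLIntegral_tupleCount_shearSeq_le {p m : ℕ} (hp : p ≠ 0)
    {𝒱 : Set (Fin m → Fin (p + m) → ℤ)} {D : ℝ≥0∞} (h𝒱 : UnimodularInvariant 𝒱)
    (hD : HasPacking 𝒱 D) {C ε δ : ℝ} (hC : 1 < C) (hε : 0 < ε)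
    (hdet : ∀ W : Fin m → Fin (p + m) → ℝ, (∀ j i, |W j i - baseTuple p m j i| ≤ ε) →
      (1 + (m + 1) * ε) ^ (p * m) < C * |(lowerBlock W).det| ^ p)
    (hδ : 0 ≤ δ) {c : Fin m → Fin (p + m) → ℝ}
    (hc : ∀ j i, |c j i - baseTuple p m j i| + δ ≤ ε) (L : LatticeSpace (p + m)) :
    ∃ u : ℕ → ℝ, Filter.Tendsto u Filter.atTop
        (nhds (2 ^ (p * m) * C * (2 * δ) ^ ((p + m) * m))) ∧
      ∀ N, (∫⁻ B in Set.Icc (-1 : Fin p → Fin m → ℝ) 1,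
        tupleCount 𝒱 (Metric.closedBall c δ) (shearSeq N B • L)) * D ≤ ENNReal.ofReal (u N) := by
  obtain ⟨g, rfl⟩ := LatticeSpace.surjective_mk _ L
  obtain ⟨R, hR, hbound⟩ := hD.tsum_indicator_mul_le g
  set e : ℝ := 1 + (m + 1) * ε with he
  have he0 : 0 < e := by positivity
  let f : ℝ → ℝ := fun x => (2 * δ) ^ (m * p) * (C / e ^ (p * m)) *
    ((2 * e + 2 * R * x) ^ p * (2 * δ + 2 * R * x) ^ m) ^ m
  have hf : Continuous f := by fun_prop
  have hf0 : f 0 = 2 ^ (p * m) * C * (2 * δ) ^ ((p + m) * m) := by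
    simp only [f, mul_zero, add_zero, mul_pow, ← pow_mul]
    rw [show (p + m) * m = m * p + m * m by ring, pow_add, pow_add, mul_comm p m]
    field_simp
  have hr : Filter.Tendsto (fun N : ℕ => (((N : ℝ) + 1) ^ p)⁻¹) Filter.atTop (nhds 0) := by
    refine Filter.Tendsto.inv_tendsto_atTop ?_
    refine (Filter.tendsto_pow_atTop hp).comp ?_
    exact Filter.tendsto_atTop_add_const_right _ _ tendsto_natCast_atTop_atTop
  refine ⟨fun N => f (((N : ℝ) + 1) ^ p)⁻¹, ?_, fun N => ?_⟩
  · rw [← hf0]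
    exact (hf.tendsto 0).comp hr
  set t : ℝ := ((N : ℝ) + 1) ^ m with ht_def
  set r : ℝ := ((N : ℝ) + 1) ^ p with hr_def
  have ht : 0 < t := by positivity
  have hr0 : 0 < r := by positivity
  have hts : t ^ p * r⁻¹ ^ m = 1 := shear_scale_eq_one p m N
  have htr : 1 ≤ t * r := by
    have h1 : (1 : ℝ) ≤ (N : ℝ) + 1 := by linarith [(Nat.cast_nonneg N : (0 : ℝ) ≤ N)]
    exact one_le_mul_of_one_le_of_one_le (one_le_pow₀ h1) (one_le_pow₀ h1)
  set κ : ℝ := ((2 * δ) ^ m * r⁻¹ ^ m / t ^ m) ^ p * (C / e ^ (p * m)) with hκ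
  set a : Fin m → Fin (p + m) → ℝ := fun j => Fin.append (fun _ : Fin p => -(r * e))
            fun l => r * (c j (Fin.natAdd p l) - δ) with ha
  set b : Fin m → Fin (p + m) → ℝ := fun j => Fin.append (fun _ : Fin p => r * e)
            fun l => r * (c j (Fin.natAdd p l) + δ) with hb
  have mQ : MeasurableSet (Metric.closedBall c δ) := Metric.isClosed_closedBall.measurableSet
  have hcont : ∀ W : Fin m → Fin (p + m) → ℝ,
      Continuous fun B : Fin p → Fin m → ℝ => fun j => (shear t r⁻¹ hts B).1.mulVec (W j) :=
    fun W => continuous_pi fun j =>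
      ((SLR.continuous_coe _).comp (continuous_shear t r⁻¹ hts)).matrix_mulVec continuous_const
  have h1 : ∀ B, tupleCount 𝒱 (Metric.closedBall c δ) (shearSeq N B • LatticeSpace.mk g) =
      ∑' V : 𝒱, (Metric.closedBall c δ).indicator 1
        (fun j => (shear t r⁻¹ hts B).1.mulVec (latticeTuple g V.1 j)) := by
    intro B
    rw [tupleCount_smul h𝒱, tupleCount_mk h𝒱]
    rfl
  calc _ = (∑' V : 𝒱, ∫⁻ B in Set.Icc (-1 : Fin p → Fin m → ℝ) 1,
        (Metric.closedBall c δ).indicator 1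
          (fun j => (shear t r⁻¹ hts B).1.mulVec (latticeTuple g V.1 j))) * D := by
        simp_rw [h1]
        rw [lintegral_tsum fun V => ?_]
        exact ((measurable_one.indicator mQ).comp (hcont _).measurable).aemeasurable
    _ ≤ (∑' V : 𝒱, ENNReal.ofReal κ * (Set.Icc a b).indicator 1 (latticeTuple g V.1)) * D := by
        gcongr with V
        exact lintegral_shear_indicator_le hp ht hr0 htr hts hC hε hdet hδ hc _
    _ = ENNReal.ofReal κ * ((∑' V : 𝒱, (Set.Icc a b).indicator 1 (latticeTuple g V.1)) * D) := by
        rw [ENNReal.tsum_mul_left, mul_assoc]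
    _ ≤ ENNReal.ofReal κ * ∏ j, ∏ i, ENNReal.ofReal (b j i - a j i + 2 * R) := by
        gcongr
        exact hbound a b
    _ = ENNReal.ofReal κ * ENNReal.ofReal
          (((2 * r * e + 2 * R) ^ p * (2 * r * δ + 2 * R) ^ m) ^ m) := by
        congr 1
        have hu : ∀ j, ∀ i : Fin p, b j (Fin.castAdd m i) - a j (Fin.castAdd m i) + 2 * R =
            2 * r * e + 2 * R := by
          intro j i
          simp only [ha, hb, Fin.append_left]
          ring
        have hl : ∀ j, ∀ l : Fin m, b j (Fin.natAdd p l) - a j (Fin.natAdd p l) + 2 * R =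
            2 * r * δ + 2 * R := by
          intro j l
          simp only [ha, hb, Fin.append_right]
          ring
        simp only [Fin.prod_univ_add, hu, hl, Finset.prod_const, Finset.card_univ,
          Fintype.card_fin]
        rw [← ENNReal.ofReal_pow (by positivity), ← ENNReal.ofReal_pow (by positivity),
          ← ENNReal.ofReal_mul (by positivity), ← ENNReal.ofReal_pow (by positivity)]
    _ = _ := by
        rw [← ENNReal.ofReal_mul (by positivity)]
        congr 1
        simp only [f, hκ]
        have e1 : 2 * r * e + 2 * R = r * (2 * e + 2 * R * r⁻¹) := by field_simp
        have e2 : 2 * r * δ + 2 * R = r * (2 * δ + 2 * R * r⁻¹) := by field_simp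
        have e3 : t ^ p = r ^ m := by
          rw [inv_pow] at hts
          field_simp at hts
          exact hts
        have e4 : (t ^ m) ^ p = (r ^ m) ^ m := by rw [← e3]; ring
        rw [e1, e2, mul_pow r, mul_pow r, div_pow, e4, mul_pow _ (r⁻¹ ^ m), ← pow_mul,
          show r ^ p * (2 * e + 2 * R * r⁻¹) ^ p * (r ^ m * (2 * δ + 2 * R * r⁻¹) ^ m) =
            (r ^ p * r ^ m) * ((2 * e + 2 * R * r⁻¹) ^ p * (2 * δ + 2 * R * r⁻¹) ^ m) by ring,
          mul_pow (r ^ p * r ^ m), mul_pow (r ^ p)]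
        generalize ((2 * e + 2 * R * r⁻¹) ^ p * (2 * δ + 2 * R * r⁻¹) ^ m) ^ m = X
        rw [inv_pow, inv_pow, ← pow_mul r p m, ← pow_mul r m p, mul_comm p m]
        field_simp

theorem intensity_closedBall_mul_le {p m : ℕ} (hp : p ≠ 0)
    {𝒱 : Set (Fin m → Fin (p + m) → ℤ)} {D : ℝ≥0∞} (h𝒱 : UnimodularInvariant 𝒱)
    (hD : HasPacking 𝒱 D) (hD0 : D ≠ 0) (hDtop : D ≠ ⊤) {μ : Measure (LatticeSpace (p + m))}
    [IsProbabilityMeasure μ] (hinv : ∀ g : SLR (p + m), Measure.map (fun x => g • x) μ = μ)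
    {C ε δ : ℝ} (hC : 1 < C) (hε : 0 < ε)
    (hdet : ∀ W : Fin m → Fin (p + m) → ℝ, (∀ j i, |W j i - baseTuple p m j i| ≤ ε) →
      (1 + (m + 1) * ε) ^ (p * m) < C * |(lowerBlock W).det| ^ p)
    (hδ : 0 ≤ δ) {c : Fin m → Fin (p + m) → ℝ}
    (hc : ∀ j i, |c j i - baseTuple p m j i| + δ ≤ ε) :
    intensity 𝒱 μ (Metric.closedBall c δ) * D ≤
      ENNReal.ofReal C * volume (Metric.closedBall c δ) := by
  have mQ : MeasurableSet (Metric.closedBall c δ) := Metric.isClosed_closedBall.measurableSet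
  set Q := Metric.closedBall c δ
  have mN : Measurable (tupleCount 𝒱 Q) := measurable_tupleCount h𝒱 mQ
  have vcube : volume (Set.Icc (-1 : Fin p → Fin m → ℝ) 1) = ENNReal.ofReal (2 ^ (p * m)) := by
    rw [volume_Icc_tuple]
    have : ∀ (i : Fin p) (j : Fin m),
        (1 : Fin p → Fin m → ℝ) i j - (-1 : Fin p → Fin m → ℝ) i j = 2 := by
      intro i j; simp; norm_num
    simp only [this, Finset.prod_const, Finset.card_univ, Fintype.card_fin]
    rw [← pow_mul, ENNReal.ofReal_pow (by positivity), mul_comm]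
  set κ := Set.Icc (-1 : Fin p → Fin m → ℝ) 1 with hκ
  have trunc : ∀ M : ℕ, (∫⁻ L, min (tupleCount 𝒱 Q L) M ∂μ) * D ≤
      ENNReal.ofReal C * volume Q := by
    intro M
    let F : LatticeSpace (p + m) → ℝ≥0∞ := fun L => min (tupleCount 𝒱 Q L) M
    have mF : Measurable F := mN.min measurable_const
    have mFN : ∀ N : ℕ, Measurable fun x : LatticeSpace (p + m) × (Fin p → Fin m → ℝ) =>
        F (shearSeq N x.2 • x.1) := by
      intro N
      refine mF.comp (Continuous.measurable ?_)
      exact ((continuous_shear _ _ _).comp continuous_snd).smul continuous_fst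
    let G : ℕ → LatticeSpace (p + m) → ℝ≥0∞ := fun N L => ∫⁻ B in κ, F (shearSeq N B • L)
    have mG : ∀ N, Measurable (G N) := fun N => (mFN N).lintegral_prod_right'
    have hG : ∀ N, ∫⁻ L, G N L ∂μ = volume κ * ∫⁻ L, F L ∂μ := by
      intro N
      rw [lintegral_lintegral_swap (mFN N).aemeasurable]
      simp_rw [lintegral_lattice_smul hinv mF]
      rw [lintegral_const, Measure.restrict_apply_univ, mul_comm]
    have hGM : ∀ N L, G N L ≤ M * volume κ := by
      intro N L
      refine (lintegral_mono fun B => min_le_right _ _).trans ?_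
      rw [lintegral_const, Measure.restrict_apply_univ]
    have hfat := limsup_lintegral_le (μ := μ) (f := G) (fun _ => (M : ℝ≥0∞) * volume κ) mG
      (fun N => Filter.Eventually.of_forall (hGM N)) (by
        rw [lintegral_const, measure_univ, mul_one, vcube]
        exact ENNReal.mul_ne_top (ENNReal.natCast_ne_top M) ENNReal.ofReal_ne_top)
    simp_rw [hG] at hfat
    rw [Filter.limsup_const] at hfat
    have hlim : ∀ L, Filter.limsup (fun N => G N L) Filter.atTop ≤
        ENNReal.ofReal (2 ^ (p * m) * C * (2 * δ) ^ ((p + m) * m)) / D := by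
      intro L
      obtain ⟨u, hu, hle⟩ := setLIntegral_tupleCount_shearSeq_le hp h𝒱 hD hC hε hdet hδ hc L
      have h1 : Filter.Tendsto (fun N => ENNReal.ofReal (u N) / D) Filter.atTop
          (nhds (ENNReal.ofReal (2 ^ (p * m) * C * (2 * δ) ^ ((p + m) * m)) / D)) :=
        ENNReal.Tendsto.div_const (ENNReal.tendsto_ofReal hu) (Or.inr hD0)
      rw [← h1.limsup_eq]
      refine Filter.limsup_le_limsup (Filter.Eventually.of_forall fun N => ?_)
      refine (ENNReal.le_div_iff_mul_le (Or.inl hD0) (Or.inl hDtop)).2 ?_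
      refine le_trans ?_ (hle N)
      gcongr
      exact lintegral_mono fun B => min_le_left _ _
    have h2 := hfat.trans (lintegral_mono hlim)
    rw [lintegral_const, measure_univ, mul_one,
      ENNReal.le_div_iff_mul_le (Or.inl hD0) (Or.inl hDtop), vcube, mul_assoc (2 ^ (p * m)),
      ENNReal.ofReal_mul (by positivity), mul_assoc,
      ENNReal.mul_le_mul_iff_right (by simp) ENNReal.ofReal_ne_top,
      ENNReal.ofReal_mul (by positivity)] at h2
    rwa [volume_closedBall_tuple hδ]
  have hsup : ∀ L, tupleCount 𝒱 Q L = ⨆ M : ℕ, min (tupleCount 𝒱 Q L) M := by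
    intro L
    rw [← inf_iSup_eq, ENNReal.iSup_natCast, inf_top_eq]
  rw [intensity_apply h𝒱 μ mQ]
  rw [lintegral_congr hsup]
  rw [lintegral_iSup (fun M => mN.min measurable_const) ?_, ENNReal.iSup_mul]
  · exact iSup_le trunc
  · intro M M' h L
    exact min_le_min le_rfl (by exact_mod_cast h)

theorem exists_SLR_mulVec_baseTuple {p m : ℕ} (hp : p ≠ 0) {x : Fin m → Fin (p + m) → ℝ}
    (hx : LinearIndependent ℝ x) :
    ∃ h : SLR (p + m), ∀ j, h.1.mulVec (baseTuple p m j) = x j := by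
  obtain ⟨U, hU⟩ := (Submodule.span ℝ (Set.range x)).exists_isCompl
  have hfin : Module.finrank ℝ U = p := by
    have h1 := Submodule.finrank_add_eq_of_isCompl hU
    rw [finrank_span_eq_card hx, Fintype.card_fin, Module.finrank_fintype_fun_eq_card,
      Fintype.card_fin] at h1
    omega
  let b := Module.finBasisOfFinrankEq ℝ U hfin
  have hb : LinearIndependent ℝ fun i => (b i : Fin (p + m) → ℝ) :=
    b.linearIndependent.map' U.subtype U.ker_subtype
  have hspan : Submodule.span ℝ (Set.range fun i => (b i : Fin (p + m) → ℝ)) ≤ U := by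
    rw [Submodule.span_le]
    rintro _ ⟨i, rfl⟩
    exact (b i).2
  have hli : LinearIndependent ℝ (Sum.elim (fun i => (b i : Fin (p + m) → ℝ)) x) :=
    hb.sum_type hx (hU.disjoint.symm.mono_left hspan)
  let f : Fin (p + m) → Fin (p + m) → ℝ :=
    Sum.elim (fun i => (b i : Fin (p + m) → ℝ)) x ∘ finSumFinEquiv.symm
  have hf : LinearIndependent ℝ f := hli.comp _ finSumFinEquiv.symm.injective
  let M : Matrix (Fin (p + m)) (Fin (p + m)) ℝ := (Matrix.of f).transpose
  have hM : M.det ≠ 0 := by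
    have : IsUnit M := Matrix.linearIndependent_cols_iff_isUnit.1 hf
    exact ((Matrix.isUnit_iff_isUnit_det M).1 this).ne_zero
  let i0 : Fin (p + m) := Fin.castAdd m ⟨0, Nat.pos_of_ne_zero hp⟩
  let d : Fin (p + m) → ℝ := Function.update 1 i0 M.det⁻¹
  refine ⟨⟨M * Matrix.diagonal d, ?_⟩, fun j => ?_⟩
  · rw [Matrix.det_mul, Matrix.det_diagonal, Finset.prod_update_of_mem (Finset.mem_univ _)]
    simp [hM]
  · have hbase : baseTuple p m j = Pi.single (Fin.natAdd p j) 1 := by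
      ext i
      refine Fin.addCases (fun i => ?_) (fun l => ?_) i
      · simp [baseTuple, Pi.single_apply, Fin.ext_iff]
        omega
      · simp [baseTuple, Pi.single_apply]
    have hne : Fin.natAdd p j ≠ i0 := by
      intro h
      have := congrArg Fin.val h
      simp [i0] at this
      exact hp this.1
    have hd : (Matrix.diagonal d).mulVec (Pi.single (Fin.natAdd p j) 1) =
        Pi.single (Fin.natAdd p j) 1 := by
      rw [Matrix.diagonal_mulVec_single]
      simp [d, hne]
    rw [← Matrix.mulVec_mulVec, hbase, hd, Matrix.mulVec_single_one]
    ext i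
    simp [M, f, Matrix.col]

theorem intensity_le_of_subset_ball {p m : ℕ} (hp : p ≠ 0)
    {𝒱 : Set (Fin m → Fin (p + m) → ℤ)} {D : ℝ≥0∞} (h𝒱 : UnimodularInvariant 𝒱)
    (hD : HasPacking 𝒱 D) (hD0 : D ≠ 0) (hDtop : D ≠ ⊤) {μ : Measure (LatticeSpace (p + m))}
    [IsProbabilityMeasure μ] (hinv : ∀ g : SLR (p + m), Measure.map (fun x => g • x) μ = μ)
    {C : ℝ} (hC : 1 < C) : ∃ ε > 0, ∀ A ⊆ Metric.ball (baseTuple p m) ε, MeasurableSet A →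
      intensity 𝒱 μ A ≤ ENNReal.ofReal C / D * volume A := by
  obtain ⟨ε, hε, hdet⟩ := exists_radius_det p m hC
  refine ⟨ε, hε, fun A hA mA => ?_⟩
  have hball : ∀ c δ, 0 ≤ δ → dist c (baseTuple p m) + δ ≤ ε →
      intensity 𝒱 μ (Metric.closedBall c δ) ≤
        ENNReal.ofReal C / D * volume (Metric.closedBall c δ) := by
    intro c δ hδ hc
    rw [ENNReal.mul_div_right_comm.symm, ENNReal.le_div_iff_mul_le (Or.inl hD0) (Or.inl hDtop)]
    refine intensity_closedBall_mul_le hp h𝒱 hD hD0 hDtop hinv hC hε hdet hδ fun j i => ?_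
    have h1 := dist_le_pi_dist c (baseTuple p m) j
    have h2 := dist_le_pi_dist (c j) (baseTuple p m j) i
    rw [Real.dist_eq] at h2
    linarith
  have hKtop : ENNReal.ofReal C / D ≠ ⊤ := ENNReal.div_ne_top ENNReal.ofReal_ne_top hD0
  set K : NNReal := (ENNReal.ofReal C / D).toNNReal with hK
  have hKK : (K : ℝ≥0∞) = ENNReal.ofReal C / D := ENNReal.coe_toNNReal hKtop
  let ρ := (intensity 𝒱 μ).restrict (Metric.ball (baseTuple p m) ε)
  have hfin : IsFiniteMeasure ρ := by
    refine ⟨?_⟩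
    rw [Measure.restrict_apply_univ]
    refine (measure_mono Metric.ball_subset_closedBall).trans_lt
      ((hball _ ε hε.le (by simp)).trans_lt ?_)
    exact ENNReal.mul_lt_top hKtop.lt_top (isCompact_closedBall _ _).measure_lt_top
  have h := (Besicovitch.vitaliFamily ρ).measure_le_of_frequently_le
    (K • (volume : Measure (Fin m → Fin (p + m) → ℝ))) (Measure.AbsolutelyContinuous.refl ρ) A ?_
  · rw [Measure.restrict_apply mA, Set.inter_eq_left.2 hA] at h
    rw [← hKK]
    exact h
  · intro x hx
    refine (Besicovitch.tendsto_filterAt ρ x).frequently (Filter.Eventually.frequently ?_)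
    have hx' := Metric.mem_ball.1 (hA hx)
    filter_upwards [Ioo_mem_nhdsGT (sub_pos.2 hx')] with δ hδ
    refine (Measure.restrict_apply_le _ _).trans ((hball x δ hδ.1.le (by linarith [hδ.2])).trans ?_)
    rw [← hKK]
    rfl

/-- **Mean value inequality** for linearly independent tuples of lattice vectors. -/
theorem intensity_le {p m : ℕ} (hp : p ≠ 0)
    {𝒱 : Set (Fin m → Fin (p + m) → ℤ)} {D : ℝ≥0∞} (h𝒱 : UnimodularInvariant 𝒱)
    (hD : HasPacking 𝒱 D) (hD0 : D ≠ 0) (hDtop : D ≠ ⊤) {μ : Measure (LatticeSpace (p + m))}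
    [IsProbabilityMeasure μ] (hinv : ∀ g : SLR (p + m), Measure.map (fun x => g • x) μ = μ)
    {A : Set (Fin m → Fin (p + m) → ℝ)} (mA : MeasurableSet A)
    (hA : ∀ x ∈ A, LinearIndependent ℝ x) : intensity 𝒱 μ A ≤ volume A / D := by
  have key : ∀ C : ℝ, 1 < C → intensity 𝒱 μ A ≤ ENNReal.ofReal C / D * volume A := by
    intro C hC
    obtain ⟨ε, hε, hloc⟩ := intensity_le_of_subset_ball hp h𝒱 hD hD0 hDtop hinv hC
    let act : SLR (p + m) → (Fin m → Fin (p + m) → ℝ) → Fin m → Fin (p + m) → ℝ :=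
      fun h x j => h.1.mulVec (x j)
    have hact : ∀ h, Continuous (act h) := fun h =>
      continuous_pi fun j => continuous_const.matrix_mulVec (continuous_apply j)
    let O : SLR (p + m) → Set (Fin m → Fin (p + m) → ℝ) := fun h =>
      act h ⁻¹' Metric.ball (baseTuple p m) ε
    have hO : ∀ h, IsOpen (O h) := fun h => Metric.isOpen_ball.preimage (hact h)
    have hcov : A ⊆ ⋃ h, O h := by
      intro x hx
      obtain ⟨h, hh⟩ := exists_SLR_mulVec_baseTuple hp (hA x hx)
      refine Set.mem_iUnion.2 ⟨h⁻¹, ?_⟩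
      have : act h⁻¹ x = baseTuple p m := by
        funext j
        simp only [act, ← hh j, Matrix.mulVec_mulVec, ← Matrix.SpecialLinearGroup.coe_mul]
        simp
      rw [Set.mem_preimage, this]
      exact Metric.mem_ball_self hε
    obtain ⟨T, hT, hTU⟩ := TopologicalSpace.isOpen_iUnion_countable O hO
    have hpiece : ∀ h, ∀ B ⊆ O h, MeasurableSet B →
        intensity 𝒱 μ B ≤ ENNReal.ofReal C / D * volume B := by
      intro h B hB mB
      have hinvr : ∀ x, act h (act h⁻¹ x) = x := by
        intro x
        funext j
        simp only [act, Matrix.mulVec_mulVec, ← Matrix.SpecialLinearGroup.coe_mul]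
        simp
      have mB' : MeasurableSet (act h⁻¹ ⁻¹' B) := (hact _).measurable mB
      have h1 := hloc (act h⁻¹ ⁻¹' B) (fun x hx => by
        have := hB hx
        rw [Set.mem_preimage, hinvr] at this
        exact this) mB'
      have h2 : intensity 𝒱 μ (act h⁻¹ ⁻¹' B) = intensity 𝒱 μ B :=
        intensity_preimage h𝒱 hinv mB h⁻¹
      have h3 : volume (act h⁻¹ ⁻¹' B) = volume B := volume_preimage_mulVec h⁻¹ mB
      rwa [h2, h3] at h1
    have hcov' : A ⊆ ⋃ h ∈ T, O h := hTU ▸ hcov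
    have := hT.to_subtype
    rcases isEmpty_or_nonempty T with hTe | hTne
    · have : A = ∅ := by
        refine Set.subset_empty_iff.1 (hcov'.trans ?_)
        rw [Set.isEmpty_coe_sort.1 hTe]
        simp
      simp [this]
    obtain ⟨e, he⟩ := exists_surjective_nat T
    have hcovN : A ⊆ ⋃ k, disjointed (fun k => O (e k)) k := by
      rw [iUnion_disjointed]
      intro x hx
      obtain ⟨h, hh, hxh⟩ := Set.mem_iUnion₂.1 (hcov' hx)
      obtain ⟨k, hk⟩ := he ⟨h, hh⟩
      exact Set.mem_iUnion.2 ⟨k, by rw [hk]; exact hxh⟩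
    have mdis : ∀ k, MeasurableSet (A ∩ disjointed (fun k => O (e k)) k) := fun k =>
      mA.inter (MeasurableSet.disjointed (fun k => (hO _).measurableSet) k)
    have hdis : Pairwise (Function.onFun Disjoint fun k =>
        A ∩ disjointed (fun k => O (e k)) k) := fun k l hkl =>
      ((disjoint_disjointed _) hkl).mono Set.inter_subset_right Set.inter_subset_right
    have hAeq : A = ⋃ k, A ∩ disjointed (fun k => O (e k)) k := by
      rw [← Set.inter_iUnion, Set.inter_eq_left.2 hcovN]
    rw [hAeq, measure_iUnion hdis mdis, measure_iUnion hdis mdis, ← ENNReal.tsum_mul_left]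
    refine ENNReal.tsum_le_tsum fun k => hpiece (e k) _ ?_ (mdis k)
    exact Set.inter_subset_right.trans (disjointed_subset _ _)
  have hlim : Filter.Tendsto (fun C : ℝ => ENNReal.ofReal C / D * volume A) (nhdsWithin 1 (Set.Ioi 1))
      (nhds (ENNReal.ofReal 1 / D * volume A)) := by
    refine ENNReal.Tendsto.mul_const (ENNReal.Tendsto.div_const ?_ (Or.inr hD0)) (Or.inl ?_)
    · exact (ENNReal.continuous_ofReal.tendsto 1).mono_left nhdsWithin_le_nhds
    · simp [hDtop]
  have := ge_of_tendsto hlim (Filter.eventually_of_mem self_mem_nhdsWithin key)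
  rwa [ENNReal.ofReal_one, mul_comm, one_div, ← div_eq_mul_inv] at this

/-- Tuples of integer vectors whose linear combination with coefficients `c` is divisible
by `q`. -/
def relTuples {m : ℕ} (n : ℕ) (q : ℕ) (c : Fin m → ℤ) : Set (Fin m → Fin n → ℤ) :=
  {V | ∃ w : Fin n → ℤ, ∑ j, c j • V j = (q : ℤ) • w}

theorem unimodularInvariant_relTuples {m : ℕ} (n : ℕ) (q : ℕ) (c : Fin m → ℤ) :
    UnimodularInvariant (relTuples n q c) := by
  rintro γ V ⟨w, hw⟩
  refine ⟨γ.1.mulVec w, ?_⟩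
  rw [← Matrix.mulVec_smul, ← hw, Matrix.mulVec_sum]
  simp_rw [Matrix.mulVec_smul]

theorem hasPacking_relTuples {m : ℕ} (n : ℕ) {q : ℕ} {c : Fin m → ℤ}
    (hu : ∃ u : Fin m → ℤ, (q : ℤ) ∣ ∑ j, c j * u j - 1) :
    HasPacking (relTuples n q c) ((q : ℝ≥0∞) ^ n) := by
  obtain ⟨u, hu⟩ := hu
  have key : ∀ V ∈ relTuples n q c, ∀ W ∈ relTuples n q c, ∀ a b : Fin n → Fin q,
      (∀ j i, V j i + u j * ((a i : ℕ) : ℤ) = W j i + u j * ((b i : ℕ) : ℤ)) → a = b := by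
    rintro V ⟨w, hw⟩ W ⟨w', hw'⟩ a b h
    ext i
    have h1 := congrFun hw i
    have h2 := congrFun hw' i
    simp only [Finset.sum_apply, Pi.smul_apply, smul_eq_mul] at h1 h2
    have h3 : ∑ j, c j * (V j i + u j * ((a i : ℕ) : ℤ)) =
        ∑ j, c j * (W j i + u j * ((b i : ℕ) : ℤ)) := by simp_rw [h]
    simp only [mul_add, Finset.sum_add_distrib, ← mul_assoc, ← Finset.sum_mul, h1, h2] at h3
    obtain ⟨d, hd⟩ := hu
    have hd' : ∑ j, c j * u j = 1 + q * d := by linarith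
    rw [hd'] at h3
    have h4 : (q : ℤ) ∣ ((b i : ℕ) : ℤ) - ((a i : ℕ) : ℤ) :=
      ⟨w i - w' i + d * ((a i : ℕ) : ℤ) - d * ((b i : ℕ) : ℤ), by linear_combination -h3⟩
    have h5 : ((a i : ℕ) : ℤ) ≡ ((b i : ℕ) : ℤ) [ZMOD q] := (Int.modEq_iff_dvd).2 h4
    exact Nat.ModEq.eq_of_lt_of_lt (Int.natCast_modEq_iff.1 h5) (a i).2 (b i).2
  let P : (Fin n → Fin q) → Set (Fin m → Fin n → ℝ) := fun a =>
    Set.univ.pi fun j => Set.univ.pi fun i =>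
      Set.Ico (u j * ((a i : ℕ) : ℝ)) (u j * ((a i : ℕ) : ℝ) + 1)
  have hfloor : ∀ V W : Fin m → Fin n → ℤ, ∀ a b, ∀ x ∈ P a, ∀ y ∈ P b,
      (∀ j i, (V j i : ℝ) + x j i = W j i + y j i) →
        ∀ j i, V j i + u j * ((a i : ℕ) : ℤ) = W j i + u j * ((b i : ℕ) : ℤ) := by
    intro V W a b x hx y hy h j i
    have h1 := hx j trivial i trivial
    have h2 := hy j trivial i trivial
    have h3 : ⌊(V j i : ℝ) + x j i⌋ = V j i + u j * ((a i : ℕ) : ℤ) := by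
      rw [Int.floor_eq_iff]
      push_cast
      constructor <;> linarith [h1.1, h1.2]
    have h4 : ⌊(W j i : ℝ) + y j i⌋ = W j i + u j * ((b i : ℕ) : ℤ) := by
      rw [Int.floor_eq_iff]
      push_cast
      constructor <;> linarith [h2.1, h2.2]
    rw [← h3, ← h4, h]
  have mP : ∀ a, MeasurableSet (P a) := fun a =>
    MeasurableSet.univ_pi fun j => MeasurableSet.univ_pi fun i => measurableSet_Ico
  have h0 : (0 : Fin m → Fin n → ℤ) ∈ relTuples n q c := ⟨0, by simp⟩
  have hdisj : Pairwise (Function.onFun Disjoint P) := fun a b hab =>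
    Set.disjoint_left.2 fun x hx hy =>
      hab (key 0 h0 0 h0 a b (hfloor 0 0 a b x hx x hy fun _ _ => rfl))
  refine ⟨⋃ a, P a, MeasurableSet.iUnion mP, ?_, ?_, ?_⟩
  · refine Bornology.isBounded_iUnion.2 fun a => ?_
    exact Bornology.IsBounded.pi fun j => Bornology.IsBounded.pi fun i => Metric.isBounded_Ico _ _
  · rw [measure_iUnion hdisj mP]
    have : ∀ a, volume (P a) = 1 := fun a => by simp [P, volume_pi_pi]
    simp [this]
  · intro V hV W hW x hx y hy h
    obtain ⟨a, hxa⟩ := Set.mem_iUnion.1 hx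
    obtain ⟨b, hyb⟩ := Set.mem_iUnion.1 hy
    have h1 := hfloor V W a b x hxa y hyb h
    have hab := key V hV W hW a b h1
    subst hab
    funext j i
    exact add_right_cancel (h1 j i)

/-- Independent tuples of vectors of `S` such that the combination with coefficients `c / q` lies
in `S` as well. -/
def relSolutions {m n : ℕ} (S : Set (Fin n → ℝ)) (q : ℕ) (c : Fin m → ℤ) :
    Set (Fin m → Fin n → ℝ) :=
  {x | LinearIndependent ℝ x ∧ (∀ j, x j ∈ S) ∧ (q : ℝ)⁻¹ • ∑ j, (c j : ℝ) • x j ∈ S}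

theorem measurableSet_relSolutions {m n : ℕ} {S : Set (Fin n → ℝ)} (hS : MeasurableSet S) (q : ℕ)
    (c : Fin m → ℤ) : MeasurableSet (relSolutions S q c) := by
  refine MeasurableSet.inter isOpen_setOfPred_linearIndependent.measurableSet
    (MeasurableSet.inter ?_ ?_)
  · have : {x : Fin m → Fin n → ℝ | ∀ j, x j ∈ S} = ⋂ j, (fun x => x j) ⁻¹' S := by ext; simp
    have h : MeasurableSet {x : Fin m → Fin n → ℝ | ∀ j, x j ∈ S} := by
      rw [this]
      exact MeasurableSet.iInter fun j => (measurable_pi_apply j) hS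
    exact h
  · exact (by fun_prop : Measurable fun x : Fin m → Fin n → ℝ =>
      (q : ℝ)⁻¹ • ∑ j, (c j : ℝ) • x j) hS

theorem volume_relSolutions_le {m n : ℕ} (S : Set (Fin n → ℝ)) (q : ℕ) (c : Fin m → ℤ) :
    volume (relSolutions S q c) ≤ volume S ^ m := by
  refine (measure_mono fun x hx => ?_ : _ ≤ volume (Set.univ.pi fun _ : Fin m => S)).trans ?_
  · exact fun j _ => hx.2.1 j
  · rw [volume_pi_pi]; simp

theorem volume_relSolutions_one_le {m n : ℕ} {S : Set (Fin n → ℝ)} (hS : MeasurableSet S)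
    {c : Fin m → ℤ} (hc : ∀ j, |c j| ≤ 1) {i j : Fin m} (hij : i ≠ j) (hi : c i ≠ 0)
    (hj : c j ≠ 0) :
    volume (relSolutions S 1 c) ≤ ENNReal.ofReal (√3 / 2) ^ n * volume S ^ m := by
  have habs : ∀ l, c l ≠ 0 → |(c l : ℝ)| = 1 := fun l hl => by
    exact_mod_cast le_antisymm (hc l) (Int.one_le_abs hl)
  refine (measure_mono ?_).trans
    (volume_pi_sum_mem_le hS (fun l => (c l : ℝ)) hij (habs i hi) (habs j hj))
  rintro x ⟨-, h1, h2⟩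
  exact ⟨h1, by simpa using h2⟩

theorem lintegral_tupleCount_relSolutions_le {p m : ℕ} (hp : p ≠ 0)
    {μ : Measure (LatticeSpace (p + m))} [IsProbabilityMeasure μ]
    (hinv : ∀ g : SLR (p + m), Measure.map (fun x => g • x) μ = μ)
    {S : Set (Fin (p + m) → ℝ)} (hS : MeasurableSet S) {q : ℕ} (hq : q ≠ 0) {c : Fin m → ℤ}
    (hu : ∃ u : Fin m → ℤ, (q : ℤ) ∣ ∑ j, c j * u j - 1) :
    ∫⁻ L, tupleCount (relTuples (p + m) q c) (relSolutions S q c) L ∂μ ≤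
      volume (relSolutions S q c) / (q : ℝ≥0∞) ^ (p + m) := by
  have hinvt := unimodularInvariant_relTuples (p + m) q c
  have mE := measurableSet_relSolutions hS q c
  rw [← intensity_apply hinvt μ mE]
  refine intensity_le hp hinvt (hasPacking_relTuples (p + m) hu) ?_ ?_ hinv mE fun x hx => hx.1
  · simp [hq]
  · simp

theorem exists_int_relation {r n : ℕ} {v : Fin r → Fin n → ℤ}
    (h : ¬ LinearIndependent ℝ fun i k => (v i k : ℝ)) :
    ∃ c : Fin r → ℤ, c ≠ 0 ∧ ∑ i, c i • v i = 0 := by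
  let A : Matrix (Fin r) (Fin n) ℤ := Matrix.of v
  have hvec : ∀ c : Fin r → ℤ, Matrix.vecMul c A = ∑ i, c i • v i := fun c => by
    ext k; simp [Matrix.vecMul, dotProduct, A]
  have hdet : (A * A.transpose).det = 0 := by
    obtain ⟨w, hw, i, hi⟩ := Fintype.not_linearIndependent_iff.1 h
    have hwA : Matrix.vecMul w (A.map (Int.castRingHom ℝ)) = 0 := by
      rw [← hw]; ext k; simp [Matrix.vecMul, dotProduct, A]
    have : ((A * A.transpose).map (Int.castRingHom ℝ)).det = 0 := by
      rw [← Matrix.exists_vecMul_eq_zero_iff]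
      refine ⟨w, fun h0 => hi (congrFun h0 i), ?_⟩
      rw [Matrix.map_mul, ← Matrix.vecMul_vecMul, hwA, Matrix.zero_vecMul]
    have h2 := RingHom.map_det (Int.castRingHom ℝ) (A * A.transpose)
    rw [RingHom.mapMatrix_apply, this] at h2
    rw [eq_intCast] at h2
    exact_mod_cast h2
  obtain ⟨c, hc, hcA⟩ := Matrix.exists_vecMul_eq_zero_iff.2 hdet
  refine ⟨c, hc, ?_⟩
  rw [← hvec, ← dotProduct_self_eq_zero]
  have : Matrix.vecMul c (A * A.transpose) ⬝ᵥ c = 0 := by rw [hcA, zero_dotProduct]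
  rwa [← Matrix.vecMul_vecMul, Matrix.vecMul_transpose, dotProduct_comm,
    Matrix.dotProduct_mulVec] at this

theorem exists_primitive_relation {r n : ℕ} {v : Fin r → Fin n → ℤ}
    (h : ¬ LinearIndependent ℝ fun i k => (v i k : ℝ)) :
    ∃ c u : Fin r → ℤ, ∑ i, c i * u i = 1 ∧ ∑ i, c i • v i = 0 := by
  obtain ⟨c, hc, hcv⟩ := exists_int_relation h
  obtain ⟨i, hi⟩ := Function.ne_iff.1 hc
  obtain ⟨c', hc', hgcd⟩ := Finset.extract_gcd c ⟨i, Finset.mem_univ i⟩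
  obtain ⟨u, hu⟩ := Finset.gcd_eq_sum_mul Finset.univ c'
  have hg : Finset.univ.gcd c ≠ 0 := fun h0 =>
    hi (Finset.gcd_eq_zero_iff.1 h0 i (Finset.mem_univ i))
  refine ⟨c', u, by rw [← hu, hgcd], ?_⟩
  refine (smul_eq_zero.1 ?_).resolve_left hg
  rw [← hcv, Finset.smul_sum]
  exact Finset.sum_congr rfl fun j hj => by rw [smul_smul, ← hc' j hj]

/-- Among the terms of a primitive relation, the one with the largest coefficient is expressed
through the others. -/
theorem exists_normalized_relation {m n : ℕ} {v : Fin (m + 1) → Fin n → ℤ}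
    (h : ¬ LinearIndependent ℝ fun i k => (v i k : ℝ)) :
    ∃ (i₀ : Fin (m + 1)) (q : ℕ) (c : Fin m → ℤ), q ≠ 0 ∧ (∀ j, |c j| ≤ q) ∧
      (∃ u : Fin m → ℤ, (q : ℤ) ∣ ∑ j, c j * u j - 1) ∧
      ∑ j, c j • v (i₀.succAbove j) = (q : ℤ) • v i₀ := by
  obtain ⟨c, u, hcu, hcv⟩ := exists_primitive_relation h
  obtain ⟨i₀, hmax⟩ := Finite.exists_max fun i => |c i|
  have h0 : c i₀ ≠ 0 := by
    intro h0
    have : ∀ i, c i = 0 := fun i => by simpa [h0] using hmax i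
    simp [this] at hcu
  rw [Fin.sum_univ_succAbove _ i₀] at hcu hcv
  have hs : (c i₀).sign * (c i₀).sign = 1 := by
    rcases lt_or_gt_of_ne h0 with h | h
    · simp [Int.sign_eq_neg_one_of_neg h]
    · simp [Int.sign_eq_one_of_pos h]
  refine ⟨i₀, (c i₀).natAbs, fun j => -(c i₀).sign * c (i₀.succAbove j), by simpa using h0,
    fun j => ?_, ⟨fun j => -(c i₀).sign * u (i₀.succAbove j), ?_⟩, ?_⟩
  · have := hmax (i₀.succAbove j)
    rw [abs_mul, abs_neg, Int.natCast_natAbs]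
    have h1 : |(c i₀).sign| = 1 := by
      rcases lt_or_gt_of_ne h0 with h | h
      · simp [Int.sign_eq_neg_one_of_neg h]
      · simp [Int.sign_eq_one_of_pos h]
    rwa [h1, one_mul]
  · have h1 : ∑ j, -(c i₀).sign * c (i₀.succAbove j) * (-(c i₀).sign * u (i₀.succAbove j)) =
        ∑ j, c (i₀.succAbove j) * u (i₀.succAbove j) :=
      Finset.sum_congr rfl fun j _ => by
        linear_combination c (i₀.succAbove j) * u (i₀.succAbove j) * hs
    rw [h1, Int.natAbs_dvd]
    exact ⟨-u i₀, by linear_combination hcu⟩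
  · have h1 : ∑ j, c (i₀.succAbove j) • v (i₀.succAbove j) = -(c i₀ • v i₀) :=
      eq_neg_of_add_eq_zero_right hcv
    simp_rw [mul_smul]
    rw [← Finset.smul_sum, h1, smul_neg, neg_smul, neg_neg, smul_smul, Int.natCast_natAbs,
      Int.sign_mul_self_eq_abs]

/-- The coefficient data `(q, c)` of the integral relations `q x₀ = ∑ c j • x j` occurring among
the vectors of a set disjoint from its negative. -/
def relIndex (m : ℕ) : Set (ℕ × (Fin m → ℤ)) :=
  {i | i.1 ≠ 0 ∧ (∀ j, |i.2 j| ≤ i.1) ∧ (∃ u : Fin m → ℤ, (i.1 : ℤ) ∣ ∑ j, i.2 j * u j - 1) ∧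
    (i.1 = 1 → ∃ j l, j ≠ l ∧ i.2 j ≠ 0 ∧ i.2 l ≠ 0)}

theorem linearIndependent_latticeTuple {m n : ℕ} (g : SLR n) {V : Fin m → Fin n → ℤ}
    (h : LinearIndependent ℝ fun j i => (V j i : ℝ)) : LinearIndependent ℝ (latticeTuple g V) := by
  refine h.map' g.1.mulVecLin (LinearMap.ker_eq_bot.2 ?_)
  refine Matrix.mulVec_injective_of_isUnit ?_
  rw [Matrix.isUnit_iff_isUnit_det, g.2]
  exact isUnit_one

theorem sum_smul_latticeTuple {m n : ℕ} (g : SLR n) (c : Fin m → ℤ) (V : Fin m → Fin n → ℤ) :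
    ∑ j, (c j : ℝ) • latticeTuple g V j =
      g.1.mulVec fun i => ((∑ j, c j • V j : Fin n → ℤ) i : ℝ) := by
  simp_rw [latticeTuple, ← Matrix.mulVec_smul, ← Matrix.mulVec_sum]
  congr 1
  ext i
  simp

theorem exists_relation_of_rank {m n : ℕ} (g : SLR n) {S : Set (Fin n → ℝ)} (hS : S ∩ -S = ∅)
    {X : Set (Fin n → ℝ)} (hXg : ∀ x ∈ X, ∃ v : Fin n → ℤ, x = g.1.mulVec fun i => (v i : ℝ))
    (hXS : X ⊆ S) (hcard : X.ncard = m + 1) (hrank : rankOf X = m) :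
    ∃ i ∈ relIndex m, ∃ V ∈ relTuples n i.1 i.2, latticeTuple g V ∈ relSolutions S i.1 i.2 ∧
      X = insert ((i.1 : ℝ)⁻¹ • ∑ j, (i.2 j : ℝ) • latticeTuple g V j)
        (Set.range (latticeTuple g V)) := by
  have hfin : X.Finite := Set.finite_of_ncard_ne_zero (by omega)
  have := hfin.to_subtype
  let e : X ≃ Fin (m + 1) := Finite.equivFinOfCardEq (by rwa [Nat.card_coe_set_eq])
  choose v hv using fun i => hXg _ (e.symm i).2
  have hx : ∀ i, latticeTuple g v i = (e.symm i : Fin n → ℝ) := fun i => (hv i).symm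
  have hrange : Set.range (latticeTuple g v) = X := by
    ext y
    refine ⟨?_, fun hy => ⟨e ⟨y, hy⟩, by simp [hx]⟩⟩
    rintro ⟨i, rfl⟩
    rw [hx]
    exact (e.symm i).2
  have hinj : Function.Injective (latticeTuple g v) := fun i j hij => by
    rw [hx, hx] at hij
    exact e.symm.injective (Subtype.ext hij)
  have hmem : ∀ i, latticeTuple g v i ∈ S := fun i => hXS (hrange ▸ Set.mem_range_self i)
  have hdep : ¬ LinearIndependent ℝ fun i k => (v i k : ℝ) := fun h => by
    have h1 := linearIndependent_iff_card_eq_finrank_span.1 (linearIndependent_latticeTuple g h)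
    rw [hrange, Fintype.card_fin] at h1
    exact absurd (h1.trans hrank) (by omega)
  obtain ⟨i₀, q, c, hq, hcq, hu, hrel⟩ := exists_normalized_relation hdep
  let V : Fin m → Fin n → ℤ := fun j => v (i₀.succAbove j)
  have hV : ∀ j, latticeTuple g V j = latticeTuple g v (i₀.succAbove j) := fun _ => rfl
  have hq' : (q : ℝ) ≠ 0 := by exact_mod_cast hq
  have hx0 : (q : ℝ)⁻¹ • ∑ j, (c j : ℝ) • latticeTuple g V j = latticeTuple g v i₀ := by
    rw [inv_smul_eq_iff₀ hq', sum_smul_latticeTuple]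
    change g.1.mulVec (fun i => ((∑ j, c j • v (i₀.succAbove j) : Fin n → ℤ) i : ℝ)) = _
    rw [hrel, latticeTuple, ← Matrix.mulVec_smul]
    congr 1
    ext i
    simp
  have hXV : X = insert ((q : ℝ)⁻¹ • ∑ j, (c j : ℝ) • latticeTuple g V j)
      (Set.range (latticeTuple g V)) := by
    rw [hx0, ← hrange]
    ext y
    simp only [Set.mem_range, Set.mem_insert_iff, Fin.exists_iff_succAbove i₀, hV, eq_comm]
  have hspan : Submodule.span ℝ X = Submodule.span ℝ (Set.range (latticeTuple g V)) := by
    rw [hXV]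
    refine Submodule.span_insert_eq_span (Submodule.smul_mem _ _ (Submodule.sum_mem _ fun j _ =>
      Submodule.smul_mem _ _ (Submodule.subset_span (Set.mem_range_self j))))
  have hLI : LinearIndependent ℝ (latticeTuple g V) := by
    rw [linearIndependent_iff_card_eq_finrank_span, Fintype.card_fin, Set.finrank, ← hspan]
    exact hrank.symm
  refine ⟨(q, c), ⟨hq, hcq, hu, fun h1 => ?_⟩, V, ⟨v i₀, hrel⟩,
    ⟨hLI, fun j => hmem _, by rw [hx0]; exact hmem i₀⟩, hXV⟩
  have h1 : q = 1 := h1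
  subst h1
  by_contra! hne
  rw [Nat.cast_one, inv_one, one_smul] at hx0
  have hneg : ∀ y ∈ S, -y ∉ S := fun y hy hy' =>
    Set.notMem_empty y (hS ▸ ⟨hy, Set.mem_neg.2 hy'⟩)
  have hne : ∀ j l, j ≠ l → c j ≠ 0 → c l = 0 := hne
  by_cases hc : ∃ j, c j ≠ 0
  · obtain ⟨j, hj⟩ := hc
    rw [Finset.sum_eq_single j (fun l _ hl => by simp [hne j l hl.symm hj]) (by simp), hV] at hx0
    have habs : |c j| = 1 := le_antisymm (by simpa using hcq j) (Int.one_le_abs hj)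
    rcases (abs_eq zero_le_one).1 habs with h | h
    · rw [h, Int.cast_one, one_smul] at hx0
      exact Fin.succAbove_ne i₀ j (hinj hx0)
    · rw [h, Int.cast_neg, Int.cast_one, neg_smul, one_smul] at hx0
      exact hneg _ (hmem _) (hx0 ▸ hmem i₀)
  · push Not at hc
    simp only [hc, Int.cast_zero, zero_smul, Finset.sum_const_zero] at hx0
    have h0 : (0 : Fin n → ℝ) ∈ S := hx0 ▸ hmem i₀
    exact hneg 0 h0 (by simpa using h0)

theorem relIndex_comp_perm {m : ℕ} {i : ℕ × (Fin m → ℤ)} (hi : i ∈ relIndex m)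
    (σ : Equiv.Perm (Fin m)) : (i.1, i.2 ∘ σ) ∈ relIndex m := by
  obtain ⟨hq, hc, ⟨u, hu⟩, h1⟩ := hi
  refine ⟨hq, fun j => hc _, ⟨u ∘ σ, ?_⟩, fun h => ?_⟩
  · rwa [← Equiv.sum_comp σ fun j => i.2 j * u j] at hu
  · obtain ⟨j, l, hjl, hj, hl⟩ := h1 h
    exact ⟨σ.symm j, σ.symm l, σ.symm.injective.ne hjl, by simpa using hj, by simpa using hl⟩

theorem relTuples_comp_perm {m n q : ℕ} {c : Fin m → ℤ} {V : Fin m → Fin n → ℤ}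
    (hV : V ∈ relTuples n q c) (σ : Equiv.Perm (Fin m)) : V ∘ σ ∈ relTuples n q (c ∘ σ) := by
  obtain ⟨w, hw⟩ := hV
  exact ⟨w, hw ▸ Equiv.sum_comp σ fun j => c j • V j⟩

theorem relSolutions_comp_perm {m n q : ℕ} {S : Set (Fin n → ℝ)} {c : Fin m → ℤ}
    {x : Fin m → Fin n → ℝ} (hx : x ∈ relSolutions S q c) (σ : Equiv.Perm (Fin m)) :
    x ∘ σ ∈ relSolutions S q (c ∘ σ) := by
  obtain ⟨hli, hxS, hsum⟩ := hx
  refine ⟨hli.comp σ σ.injective, fun j => hxS _, ?_⟩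
  rwa [← Equiv.sum_comp σ fun j => (c j : ℝ) • x j] at hsum

theorem factorial_mul_rho_le {m n : ℕ} {S : Set (Fin n → ℝ)} (hS : S ∩ -S = ∅)
    (L : LatticeSpace n) :
    (m.factorial : ℝ≥0∞) * rho (m + 1) m (latticeOf L ∩ S) ≤
      ∑' i : relIndex m, tupleCount (relTuples n i.1.1 i.1.2) (relSolutions S i.1.1 i.1.2) L := by
  set g : SLR n := Quotient.out (α := SLR n) L with hg
  set 𝒳 : Set (Set (Fin n → ℝ)) :=
    {X | X ⊆ latticeOf L ∩ S ∧ X.ncard = m + 1 ∧ rankOf X = m} with h𝒳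
  have hex : ∀ X : 𝒳, ∃ i ∈ relIndex m, ∃ V ∈ relTuples n i.1 i.2,
      latticeTuple g V ∈ relSolutions S i.1 i.2 ∧
        X.1 = insert ((i.1 : ℝ)⁻¹ • ∑ j, (i.2 j : ℝ) • latticeTuple g V j)
          (Set.range (latticeTuple g V)) := fun X =>
    exists_relation_of_rank g hS (fun x hx => (X.2.1 hx).1) (fun x hx => (X.2.1 hx).2) X.2.2.1
      X.2.2.2
  choose i hi V hV hsol hX using hex
  let f : 𝒳 × Equiv.Perm (Fin m) → Σ i : relIndex m, relTuples n i.1.1 i.1.2 := fun p =>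
    ⟨⟨((i p.1).1, (i p.1).2 ∘ p.2), relIndex_comp_perm (hi p.1) p.2⟩,
      ⟨V p.1 ∘ p.2, relTuples_comp_perm (hV p.1) p.2⟩⟩
  have hf : Function.Injective f := by
    rintro ⟨X, σ⟩ ⟨X', σ'⟩ h
    have h1 : (i X).1 = (i X').1 := congrArg (fun s => s.1.1.1) h
    have h2 : (i X).2 ∘ σ = (i X').2 ∘ σ' := congrArg (fun s => s.1.1.2) h
    have h3 : V X ∘ σ = V X' ∘ σ' := congrArg (fun s => s.2.1) h
    have hXσ : ∀ (X : 𝒳) (σ : Equiv.Perm (Fin m)), X.1 =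
        insert (((i X).1 : ℝ)⁻¹ • ∑ j, (((i X).2 ∘ σ) j : ℝ) • latticeTuple g (V X ∘ σ) j)
          (Set.range (latticeTuple g (V X ∘ σ))) := fun X σ => by
      have hr : Set.range (latticeTuple g (V X ∘ σ)) = Set.range (latticeTuple g (V X)) :=
        σ.surjective.range_comp (latticeTuple g (V X))
      have hs := Equiv.sum_comp σ fun j => ((i X).2 j : ℝ) • latticeTuple g (V X) j
      rw [hr]
      refine (hX X).trans ?_
      rw [← hs]
      rfl
    have hXX : X = X' := Subtype.ext ((hXσ X σ).trans (by rw [h1, h2, h3, ← hXσ X' σ']))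
    subst hXX
    have hVinj : Function.Injective (V X) := fun a b hab =>
      (hsol X).1.injective (by simp [latticeTuple, hab])
    rw [Prod.mk.injEq]
    exact ⟨rfl, Equiv.ext fun j => hVinj (congrFun h3 j)⟩
  let F : (Σ i : relIndex m, relTuples n i.1.1 i.1.2) → ℝ≥0∞ := fun s =>
    (relSolutions S s.1.1.1 s.1.1.2).indicator 1 (latticeTuple g s.2.1)
  have hF : ∀ p, F (f p) = 1 := fun p =>
    Set.indicator_of_mem (relSolutions_comp_perm (hsol p.1) p.2) _
  calc (m.factorial : ℝ≥0∞) * rho (m + 1) m (latticeOf L ∩ S)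
      ≤ ∑' p : 𝒳 × Equiv.Perm (Fin m), F (f p) := by
        simp_rw [hF, ENNReal.tsum_const, mul_one]
        change (m.factorial : ℝ≥0∞) * (𝒳.ncard : ℕ) ≤ _
        by_cases hfin : 𝒳.Finite
        · have := hfin.to_subtype
          rw [ENat.card_eq_coe_natCard, Nat.card_prod, Nat.card_coe_set_eq, Nat.card_perm,
            Nat.card_fin, mul_comm, ENat.toENNReal_coe, Nat.cast_mul]
        · simp [Set.Infinite.ncard hfin]
    _ ≤ ∑' s, F s := ENNReal.tsum_comp_le_tsum_of_injective hf F
    _ = _ := ENNReal.tsum_sigma' F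

theorem tsum_relIndex_le (m : ℕ) (b : ℕ → ℝ≥0∞) :
    ∑' i : relIndex m, b i.1.1 ≤ ∑' q : ℕ, ((2 * q + 1 : ℕ) : ℝ≥0∞) ^ m * b q := by
  let box : ℕ → Finset (Fin m → ℤ) := fun q => Fintype.piFinset fun _ => Finset.Icc (-(q : ℤ)) q
  have hcard : ∀ q, (box q).card = (2 * q + 1) ^ m := fun q => by
    have : ((q : ℤ) + 1 + q).toNat = 2 * q + 1 := by omega
    simp [box, Fintype.card_piFinset, this]
  calc ∑' i : relIndex m, b i.1.1
      = ∑' i, (relIndex m).indicator (fun i : ℕ × (Fin m → ℤ) => b i.1) i :=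
        tsum_subtype _ fun i : ℕ × (Fin m → ℤ) => b i.1
    _ ≤ ∑' i : ℕ × (Fin m → ℤ), (if i.2 ∈ box i.1 then b i.1 else 0) := by
        refine ENNReal.tsum_le_tsum fun i => ?_
        by_cases hi : i ∈ relIndex m
        swap
        · simp [hi]
        have : i.2 ∈ box i.1 := Fintype.mem_piFinset.2 fun j =>
          Finset.mem_Icc.2 (abs_le.1 (hi.2.1 j))
        simp [hi, this]
    _ = ∑' q : ℕ, ∑' c : Fin m → ℤ, (if c ∈ box q then b q else 0) :=
        ENNReal.tsum_prod (f := fun q c => if c ∈ box q then b q else 0)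
    _ = ∑' q : ℕ, ((2 * q + 1 : ℕ) : ℝ≥0∞) ^ m * b q := by
        refine tsum_congr fun q => ?_
        rw [tsum_eq_sum (s := box q) fun c hc => if_neg hc,
          Finset.sum_congr rfl fun c hc => if_pos hc, Finset.sum_const, hcard, nsmul_eq_mul, Nat.cast_pow]

theorem tail_term_le {p : ℕ} (hp : 2 ≤ p) (m q : ℕ) :
    (2 * q + 5 : ℝ) ^ m / (q + 2) ^ (p + m) ≤
      4 * 5 ^ m / 2 ^ (p + m) * (1 / (q + 1) - 1 / (q + 2)) := by
  obtain ⟨r, rfl⟩ := Nat.exists_eq_add_of_le hp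
  have hq : (0 : ℝ) ≤ q := q.cast_nonneg
  have h1 : (2 * q + 5 : ℝ) ^ m ≤ (5 / 2 * (q + 2)) ^ m := by gcongr; linarith
  have h2 : (2 : ℝ) ^ r ≤ (q + 2) ^ r := by gcongr; linarith
  have h3 : (1 / (q + 1) - 1 / (q + 2) : ℝ) = 1 / ((q + 1) * (q + 2)) := by field_simp; ring
  have h4 : (4 * 5 ^ m / 2 ^ (2 + r + m) : ℝ) = (5 / 2) ^ m / 2 ^ r := by
    rw [pow_add, pow_add, div_pow]; field_simp; norm_num
  rw [h3, h4, div_mul_div_comm, mul_one]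
  calc (2 * q + 5 : ℝ) ^ m / (q + 2) ^ (2 + r + m)
      ≤ (5 / 2 * (q + 2)) ^ m / (q + 2) ^ (2 + r + m) := by gcongr
    _ = (5 / 2) ^ m / ((q + 2) ^ r * ((q + 2) * (q + 2))) := by
        rw [mul_pow, pow_add, pow_add]; field_simp
    _ ≤ (5 / 2) ^ m / (2 ^ r * ((q + 1) * (q + 2))) := by gcongr; linarith

theorem tsum_tail_le {p : ℕ} (hp : 2 ≤ p) (m : ℕ) :
    ∑' q : ℕ, ENNReal.ofReal ((2 * q + 5 : ℝ) ^ m / (q + 2) ^ (p + m)) ≤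
      ENNReal.ofReal (4 * 5 ^ m / 2 ^ (p + m)) := by
  refine ENNReal.tsum_le_of_sum_range_le fun N => ?_
  rw [← ENNReal.ofReal_sum_of_nonneg fun q _ => by positivity]
  refine ENNReal.ofReal_le_ofReal ?_
  have htel : ∑ q ∈ Finset.range N, (1 / ((q : ℝ) + 1) - 1 / (q + 2)) = 1 - 1 / (N + 1) := by
    have := Finset.sum_range_sub' (fun q : ℕ => 1 / ((q : ℝ) + 1)) N
    simpa [add_assoc, one_add_one_eq_two] using this
  calc ∑ q ∈ Finset.range N, (2 * q + 5 : ℝ) ^ m / (q + 2) ^ (p + m)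
      ≤ ∑ q ∈ Finset.range N, 4 * 5 ^ m / 2 ^ (p + m) * (1 / ((q : ℝ) + 1) - 1 / (q + 2)) :=
        Finset.sum_le_sum fun q _ => tail_term_le hp m q
    _ = 4 * 5 ^ m / 2 ^ (p + m) * (1 - 1 / (N + 1)) := by rw [← Finset.mul_sum, htel]
    _ ≤ 4 * 5 ^ m / 2 ^ (p + m) := by
        refine mul_le_of_le_one_right (by positivity) ?_
        have : (0 : ℝ) ≤ 1 / (N + 1) := by positivity
        linarith

/-- The bound, relative to `volume S ^ m`, for the mean number of solutions of a relation with
denominator `q`. -/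
def relWeight (n : ℕ) : ℕ → ℝ≥0∞
  | 0 => 0
  | 1 => ENNReal.ofReal ((√3 / 2) ^ n)
  | q + 2 => ENNReal.ofReal (1 / (q + 2 : ℝ) ^ n)

theorem volume_relSolutions_div_le {m n : ℕ} {S : Set (Fin n → ℝ)} (hS : MeasurableSet S)
    {i : ℕ × (Fin m → ℤ)} (hi : i ∈ relIndex m) :
    volume (relSolutions S i.1 i.2) / (i.1 : ℝ≥0∞) ^ n ≤ relWeight n i.1 * volume S ^ m := by
  obtain ⟨q, c⟩ := i
  obtain ⟨hq, hc, -, h1⟩ := hi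
  match q, hq, hc, h1 with
  | 1, _, hc, h1 =>
    obtain ⟨j, l, hjl, hj, hl⟩ := h1 rfl
    have := volume_relSolutions_one_le hS (fun j => by simpa using hc j) hjl hj hl
    simpa [relWeight, ENNReal.ofReal_pow (by positivity : 0 ≤ √3 / 2)] using this
  | q + 2, _, _, _ =>
    have hw : relWeight n (q + 2) = (((q + 2 : ℕ) : ℝ≥0∞) ^ n)⁻¹ := by
      rw [relWeight, one_div, ENNReal.ofReal_inv_of_pos (by positivity),
        ENNReal.ofReal_pow (by positivity)]
      congr 2
      rw [← ENNReal.ofReal_natCast]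
      simp
    rw [hw, mul_comm, ← div_eq_mul_inv]
    exact ENNReal.div_le_div_right (volume_relSolutions_le S _ _) _

theorem tsum_relWeight_le {p : ℕ} (hp : 2 ≤ p) (m : ℕ) :
    ∑' q : ℕ, ((2 * q + 1 : ℕ) : ℝ≥0∞) ^ m * relWeight (p + m) q ≤
      ENNReal.ofReal (3 ^ m * (√3 / 2) ^ (p + m) + 4 * 5 ^ m / 2 ^ (p + m)) := by
  rw [tsum_eq_zero_add' ENNReal.summable, tsum_eq_zero_add' ENNReal.summable,
    ENNReal.ofReal_add (by positivity) (by positivity)]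
  have h0 : relWeight (p + m) 0 = 0 := rfl
  rw [h0, mul_zero, zero_add]
  refine add_le_add (le_of_eq ?_) ?_
  · rw [ENNReal.ofReal_mul (by positivity), ENNReal.ofReal_pow (by positivity)]
    simp [relWeight]
  · refine le_of_eq_of_le (tsum_congr fun q => ?_) (tsum_tail_le hp m)
    rw [div_eq_mul_one_div, ENNReal.ofReal_mul (by positivity), ENNReal.ofReal_pow (by positivity)]
    congr 2
    rw [← ENNReal.ofReal_natCast]
    congr 1
    push_cast
    ring

theorem factorial_mul_lintegral_rho_le {p m : ℕ} (hp : 2 ≤ p)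
    {μ : Measure (LatticeSpace (p + m))} [IsProbabilityMeasure μ]
    (hinv : ∀ g : SLR (p + m), Measure.map (fun x => g • x) μ = μ)
    {S : Set (Fin (p + m) → ℝ)} (hS : MeasurableSet S) (hsymm : S ∩ -S = ∅) :
    (m.factorial : ℝ≥0∞) * ∫⁻ L, (rho (m + 1) m (latticeOf L ∩ S) : ℝ≥0∞) ∂μ ≤
      ENNReal.ofReal (3 ^ m * (√3 / 2) ^ (p + m) + 4 * 5 ^ m / 2 ^ (p + m)) * volume S ^ m := by
  calc (m.factorial : ℝ≥0∞) * ∫⁻ L, (rho (m + 1) m (latticeOf L ∩ S) : ℝ≥0∞) ∂μ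
      ≤ ∫⁻ L, (m.factorial : ℝ≥0∞) * (rho (m + 1) m (latticeOf L ∩ S) : ℝ≥0∞) ∂μ :=
        lintegral_const_mul_le _ _
    _ ≤ ∫⁻ L, ∑' i : relIndex m,
          tupleCount (relTuples (p + m) i.1.1 i.1.2) (relSolutions S i.1.1 i.1.2) L ∂μ :=
        lintegral_mono fun L => factorial_mul_rho_le hsymm L
    _ = ∑' i : relIndex m, ∫⁻ L,
          tupleCount (relTuples (p + m) i.1.1 i.1.2) (relSolutions S i.1.1 i.1.2) L ∂μ :=
        lintegral_tsum fun i => (measurable_tupleCount (unimodularInvariant_relTuples _ _ _)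
          (measurableSet_relSolutions hS _ _)).aemeasurable
    _ ≤ ∑' i : relIndex m, relWeight (p + m) i.1.1 * volume S ^ m :=
        ENNReal.tsum_le_tsum fun i => (lintegral_tupleCount_relSolutions_le (by omega) hinv hS
          i.2.1 i.2.2.2.1).trans (volume_relSolutions_div_le hS i.2)
    _ ≤ _ := by
        rw [ENNReal.tsum_mul_right]
        gcongr
        exact (tsum_relIndex_le m _).trans (tsum_relWeight_le hp m)

/-- **Schmidt's estimate (1.10).** For a Borel set `S ⊆ ℝⁿ` with `S ∩ (-S) = ∅` and
`λ = Vol(S) ∈ (0, ∞)`, an `SL(n,ℝ)`-invariant Borel probability measure `μ` on the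
space of covolume-one lattices, and `1 ≤ k ≤ n - 1`, the expected number of `k`-element
subsets of `L ∩ S` of rank `k - 1` is at most
`(λ^{k-1}/(k-1)!) · (3ᵏ (3/4)^{n/2} + 5ᵏ 2^{-n})`. -/
theorem expected_rho_k_k_sub_one_le
    (n : ℕ) (hn : 1 ≤ n)
    (S : Set (Fin n → ℝ)) (hSmeas : MeasurableSet S)
    (hSsym : S ∩ (-S) = ∅) (hS0 : 0 < volume S) (hSfin : volume S < ⊤)
    (μ : Measure (LatticeSpace n)) (hprob : IsProbabilityMeasure μ)
    (hinv : ∀ g : SLR n, Measure.map (fun x => g • x) μ = μ)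
    (k : ℕ) (hk1 : 1 ≤ k) (hk : k ≤ n - 1) :
    ∫⁻ L, (rho k (k - 1) (latticeOf L ∩ S) : ℝ≥0∞) ∂μ
      ≤ ENNReal.ofReal
          ((volume S).toReal ^ (k - 1) / (Nat.factorial (k - 1)) *
            ((3 : ℝ) ^ k * ((3 : ℝ) / 4) ^ ((n : ℝ) / 2)
              + (5 : ℝ) ^ k * (2 : ℝ) ^ (-(n : ℝ)))) := by
  obtain ⟨m, rfl⟩ : ∃ m, k = m + 1 := ⟨k - 1, by omega⟩
  obtain ⟨p, rfl⟩ : ∃ p, n = p + m := ⟨n - m, by omega⟩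
  have hp : 2 ≤ p := by omega
  have key := factorial_mul_lintegral_rho_le hp hinv hSmeas hSsym
  rw [Nat.add_sub_cancel]
  have hm : (m.factorial : ℝ≥0∞) ≠ 0 := by exact_mod_cast m.factorial_ne_zero
  rw [← ENNReal.mul_le_mul_iff_right hm (ENNReal.natCast_ne_top _)]
  refine key.trans ?_
  rw [← ENNReal.ofReal_toReal hSfin.ne, ← ENNReal.ofReal_pow ENNReal.toReal_nonneg,
    ← ENNReal.ofReal_mul (by positivity), ← ENNReal.ofReal_natCast,
    ← ENNReal.ofReal_mul (by positivity), ENNReal.toReal_ofReal ENNReal.toReal_nonneg]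
  refine ENNReal.ofReal_le_ofReal ?_
  have hf : (m.factorial : ℝ) ≠ 0 := by exact_mod_cast m.factorial_ne_zero
  have hsqrt : ((3 : ℝ) / 4) ^ (((p + m : ℕ) : ℝ) / 2) = (√3 / 2) ^ (p + m) := by
    have h : √((3 : ℝ) / 4) = √3 / 2 := by
      rw [Real.sqrt_div' _ (by norm_num), show (4 : ℝ) = 2 ^ 2 by norm_num,
        Real.sqrt_sq (by norm_num)]
    rw [Real.rpow_div_two_eq_sqrt _ (by norm_num), h, Real.rpow_natCast]
  rw [hsqrt, Real.rpow_neg (by norm_num), Real.rpow_natCast, ← mul_assoc, mul_div_cancel₀ _ hf,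
    mul_comm]
  gcongr ?_ * (?_ + ?_)
  · gcongr <;> simp
  · rw [div_eq_mul_inv, pow_succ, mul_comm (4 : ℝ)]
    gcongr
    norm_num
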